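/- arXiv:math-ph/0108023 — 2 statements merged into one kernel-verified Lean document; each statement's English description precedes it below -/
import Mathlib

section
/- Let g: ℝ → ℝ be smooth with g'' not identically zero. The Klein–Gordon equation u_tx = g(u) admits a conservation-law multiplier Λ(x,u,u_x,u_xx,u_xxx) whose partial derivative with respect to the variable u_xxx is not identically zero if and only if there exist real constants such that g has one of the following forms: g(u) = α·e^{σu} with α·σ ≠ 0; or g(u) = α·sin(σu + β) with α·σ ≠ 0; or g(u) = α·e^{σu} + γ·e^{−σu} with σ ≠ 0 and α·γ ≠ 0. (Up to scalings of t, x, u and a translation of u these are the Liouville equation u_tx = e^u, the sine-Gordon equation u_tx = sin u, and the sinh-Gordon equations u_tx = e^u ± e^{−u}.) -/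
noncomputable section

/-- Partial derivative with respect to the first variable (t). -/
def pdt (u : ℝ → ℝ → ℝ) : ℝ → ℝ → ℝ := fun t x => deriv (fun s => u s x) t

/-- Partial derivative with respect to the second variable (x). -/
def pdx (u : ℝ → ℝ → ℝ) : ℝ → ℝ → ℝ := fun t x => deriv (fun y => u t y) x

/-- Mixed partial derivative ∂_t^i ∂_x^j u. -/
def pd (i j : ℕ) (u : ℝ → ℝ → ℝ) : ℝ → ℝ → ℝ := pdt^[i] (pdx^[j] u)

/-- Index set for the partial derivatives ∂_t^i ∂_x^j u of total order i + j ≤ n. -/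
abbrev JetIdx (n : ℕ) := {p : Fin (n + 1) × Fin (n + 1) // (p.1 : ℕ) + (p.2 : ℕ) ≤ n}

/-- The collection of all partial derivatives of u of total order ≤ n at (t,x). -/
def jet (n : ℕ) (u : ℝ → ℝ → ℝ) (t x : ℝ) : JetIdx n → ℝ :=
  fun p => pd (p.1.1 : ℕ) (p.1.2 : ℕ) u t x

/-- Smoothness of a function of two real variables. -/
def Smooth2 (u : ℝ → ℝ → ℝ) : Prop :=
  ContDiff ℝ (⊤ : ℕ∞) (fun p : ℝ × ℝ => u p.1 p.2)

/-- Smoothness of a function of five real variables. -/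
def Smooth5 (Λ : ℝ → ℝ → ℝ → ℝ → ℝ → ℝ) : Prop :=
  ContDiff ℝ (⊤ : ℕ∞)
    (fun v : ℝ × ℝ × ℝ × ℝ × ℝ => Λ v.1 v.2.1 v.2.2.1 v.2.2.2.1 v.2.2.2.2)

/-- `Λ(x,u,u_x,u_xx,u_xxx)` is a conservation-law multiplier for the
Klein–Gordon equation `u_tx = g(u)` in light-cone coordinates:  there are
smooth fluxes `Φᵗ, Φˣ`, depending on `t`, `x` and the partial derivatives of
`u` of total order at most `4`, such that
`(u_tx − g(u))·Λ = D_t Φᵗ + D_x Φˣ` holds pointwise for every smooth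
`u : ℝ² → ℝ`. -/
def IsMultiplierKG (g : ℝ → ℝ) (Λ : ℝ → ℝ → ℝ → ℝ → ℝ → ℝ) : Prop :=
  ∃ Φt Φx : ℝ × ℝ × (JetIdx 4 → ℝ) → ℝ,
    ContDiff ℝ (⊤ : ℕ∞) Φt ∧ ContDiff ℝ (⊤ : ℕ∞) Φx ∧
    ∀ u : ℝ → ℝ → ℝ, Smooth2 u → ∀ t x : ℝ,
      (pd 1 1 u t x - g (u t x)) *
          Λ x (u t x) (pd 0 1 u t x) (pd 0 2 u t x) (pd 0 3 u t x)
        = deriv (fun s => Φt (s, x, jet 4 u s x)) t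
          + deriv (fun y => Φx (t, y, jet 4 u t y)) x

open MeasureTheory
open scoped ContDiff

/-- The directional derivative of `h` along the constant vector field `v`. -/
def dirDeriv {E : Type*} [NormedAddCommGroup E] [NormedSpace ℝ E] (v : E) (h : E → ℝ) : E → ℝ :=
  fun y => fderiv ℝ h y v

section DirDeriv

variable {E : Type*} [NormedAddCommGroup E] [NormedSpace ℝ E] {v w : E} {f h : E → ℝ}

theorem ContDiff.dirDeriv (hf : ContDiff ℝ ∞ f) (v : E) : ContDiff ℝ ∞ (dirDeriv v f) :=
  (hf.fderiv_right (by simp)).clm_apply contDiff_const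

theorem contDiff_funAdd (hf : ContDiff ℝ ∞ f) (hh : ContDiff ℝ ∞ h) : ContDiff ℝ ∞ (f + h) :=
  hf.add hh

theorem contDiff_funSub (hf : ContDiff ℝ ∞ f) (hh : ContDiff ℝ ∞ h) : ContDiff ℝ ∞ (f - h) :=
  hf.sub hh

theorem contDiff_funMul (hf : ContDiff ℝ ∞ f) (hh : ContDiff ℝ ∞ h) : ContDiff ℝ ∞ (f * h) :=
  hf.mul hh

theorem ContDiff.hasFDerivAt_infty (hf : ContDiff ℝ ∞ f) (y : E) :
    HasFDerivAt f (fderiv ℝ f y) y :=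
  (hf.differentiable (by simp) y).hasFDerivAt

theorem dirDeriv_add (hf : ContDiff ℝ ∞ f) (hh : ContDiff ℝ ∞ h) :
    dirDeriv v (f + h) = dirDeriv v f + dirDeriv v h := by
  funext y
  simp [dirDeriv, ((hf.hasFDerivAt_infty y).add (hh.hasFDerivAt_infty y)).fderiv]

theorem dirDeriv_sub (hf : ContDiff ℝ ∞ f) (hh : ContDiff ℝ ∞ h) :
    dirDeriv v (f - h) = dirDeriv v f - dirDeriv v h := by
  funext y
  simp [dirDeriv, ((hf.hasFDerivAt_infty y).sub (hh.hasFDerivAt_infty y)).fderiv]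

theorem dirDeriv_mul (hf : ContDiff ℝ ∞ f) (hh : ContDiff ℝ ∞ h) :
    dirDeriv v (f * h) = dirDeriv v f * h + f * dirDeriv v h := by
  funext y
  simp [dirDeriv, ((hf.hasFDerivAt_infty y).mul (hh.hasFDerivAt_infty y)).fderiv]
  ring

theorem dirDeriv_smul (hf : ContDiff ℝ ∞ f) (c : ℝ) :
    dirDeriv v (c • f) = c • dirDeriv v f := by
  funext y
  simp [dirDeriv, ((hf.hasFDerivAt_infty y).const_smul c).fderiv]

theorem dirDeriv_comm (hf : ContDiff ℝ ∞ f) :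
    dirDeriv v (dirDeriv w f) = dirDeriv w (dirDeriv v f) := by
  funext y
  have key : ∀ a b : E, dirDeriv a (dirDeriv b f) y = fderiv ℝ (fderiv ℝ f) y a b := by
    intro a b
    have h1 : HasFDerivAt (fderiv ℝ f) (fderiv ℝ (fderiv ℝ f) y) y :=
      ((hf.fderiv_right (m := ∞) (by simp)).differentiable (by simp) y).hasFDerivAt
    have h2 := h1.clm_apply (hasFDerivAt_const b y)
    have h3 : fderiv ℝ (dirDeriv b f) y = _ := h2.fderiv
    rw [dirDeriv, h3]
    simp
  rw [key, key]
  exact (hf.contDiffAt.isSymmSndFDerivAt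
    (by simpa using WithTop.coe_le_coe.2 (le_top (a := (2 : ℕ∞))))).eq v w

theorem HasCompactSupport.dirDeriv (hf : HasCompactSupport f) (v : E) :
    HasCompactSupport (dirDeriv v f) :=
  hf.fderiv_apply ℝ v

theorem tsupport_dirDeriv_subset (v : E) (f : E → ℝ) : tsupport (dirDeriv v f) ⊆ tsupport f :=
  tsupport_fderiv_apply_subset ℝ v

/-- Restricting a function to an affine line does not affect its derivative along the line. -/
theorem hasDerivAt_dirDeriv_line (hf : ContDiff ℝ ∞ f) (a v : E) (s : ℝ) :
    HasDerivAt (fun r : ℝ => f (a + r • v)) (dirDeriv v f (a + s • v)) s := by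
  have h1 : HasDerivAt (fun r : ℝ => a + r • v) v s := by
    simpa using ((hasDerivAt_id s).smul_const v).const_add a
  exact (hf.hasFDerivAt_infty (a + s • v)).comp_hasDerivAt s h1

theorem dirDeriv_eq_zero_of_eq_on_line {y : E} (h : ∀ r : ℝ, f (y + r • v) = f y)
    (hf : ContDiff ℝ ∞ f) : dirDeriv v f y = 0 := by
  have h1 := hasDerivAt_dirDeriv_line hf y v 0
  simp only [h, zero_smul, add_zero] at h1
  exact h1.unique (hasDerivAt_const _ _)

end DirDeriv

section Integration

variable {E : Type*} [NormedAddCommGroup E] [NormedSpace ℝ E]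
  [MeasurableSpace E] [BorelSpace E] {μ : Measure E} [μ.IsAddHaarMeasure] {v : E} {w h : E → ℝ}

theorem integrable_mul_of_hasCompactSupport (hw : ContDiff ℝ ∞ w) (hc : HasCompactSupport w)
    (hh : ContDiff ℝ ∞ h) : Integrable (fun y => w y * h y) μ :=
  (hw.continuous.mul hh.continuous).integrable_of_hasCompactSupport (hc.mul_right (f' := h))

theorem integral_dirDeriv_mul [FiniteDimensional ℝ E] (hw : ContDiff ℝ ∞ w)
    (hc : HasCompactSupport w) (hh : ContDiff ℝ ∞ h) :
    ∫ y, dirDeriv v w y * h y ∂μ = - ∫ y, w y * dirDeriv v h y ∂μ := by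
  have := integral_mul_fderiv_eq_neg_fderiv_mul_of_integrable (μ := μ) (v := v)
    (integrable_mul_of_hasCompactSupport (hw.dirDeriv v) (hc.dirDeriv v) hh)
    (integrable_mul_of_hasCompactSupport hw hc (hh.dirDeriv v))
    (integrable_mul_of_hasCompactSupport hw hc hh)
    (fun y _ => hw.differentiable (by simp) y) (fun y _ => hh.differentiable (by simp) y)
  simp only [dirDeriv]
  linarith

theorem integral_dirDeriv_eq_zero [FiniteDimensional ℝ E] (hw : ContDiff ℝ ∞ w)
    (hc : HasCompactSupport w) :
    ∫ y, dirDeriv v w y ∂μ = 0 := by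
  have := integral_dirDeriv_mul (μ := μ) (v := v) hw hc (contDiff_const (c := (1 : ℝ)))
  simpa [dirDeriv] using this

theorem eq_zero_of_integral_mul_eq_zero [FiniteDimensional ℝ E] (hh : ContDiff ℝ ∞ h)
    (H : ∀ w : E → ℝ, ContDiff ℝ ∞ w → HasCompactSupport w → ∫ y, w y * h y ∂μ = 0) :
    h = 0 := by
  have h1 : ∀ᵐ y ∂μ, h y = 0 :=
    ae_eq_zero_of_integral_contDiff_smul_eq_zero hh.continuous.locallyIntegrable
      (by simpa using H)
  exact Continuous.ae_eq_iff_eq μ hh.continuous continuous_const |>.1 h1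

end Integration

/-- The mixed partial derivative `∂_t^i ∂_x^j` of a function on the plane. -/
def mixedDeriv (i j : ℕ) (W : ℝ × ℝ → ℝ) : ℝ × ℝ → ℝ :=
  (dirDeriv (1, 0))^[i] ((dirDeriv (0, 1))^[j] W)

section MixedDeriv

variable {W w : ℝ × ℝ → ℝ}

theorem iterate_dirDeriv_smooth {E : Type*} [NormedAddCommGroup E] [NormedSpace ℝ E] {f : E → ℝ}
    (hf : ContDiff ℝ ∞ f) (v : E) (n : ℕ) : ContDiff ℝ ∞ ((dirDeriv v)^[n] f) := by
  induction n with
  | zero => exact hf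
  | succ n ih => rw [Function.iterate_succ_apply']; exact ih.dirDeriv v

theorem ContDiff.mixedDeriv (hW : ContDiff ℝ ∞ W) (i j : ℕ) :
    ContDiff ℝ ∞ (mixedDeriv i j W) :=
  iterate_dirDeriv_smooth (iterate_dirDeriv_smooth hW _ _) _ _

theorem dirDeriv_fst_mixedDeriv (i j : ℕ) :
    dirDeriv (1, 0) (mixedDeriv i j W) = mixedDeriv (i + 1) j W := by
  rw [mixedDeriv, mixedDeriv, Function.iterate_succ_apply']

theorem dirDeriv_snd_mixedDeriv (hW : ContDiff ℝ ∞ W) (i j : ℕ) :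
    dirDeriv (0, 1) (mixedDeriv i j W) = mixedDeriv i (j + 1) W := by
  induction i with
  | zero => simp only [mixedDeriv, Function.iterate_succ_apply', Function.iterate_zero, id]
  | succ i ih =>
    rw [← dirDeriv_fst_mixedDeriv, ← dirDeriv_fst_mixedDeriv, ← ih,
      dirDeriv_comm (hW.mixedDeriv i j)]

theorem iterate_dirDeriv_add_smul {E : Type*} [NormedAddCommGroup E] [NormedSpace ℝ E]
    {f h : E → ℝ} (hf : ContDiff ℝ ∞ f) (hh : ContDiff ℝ ∞ h) (c : ℝ) (v : E) (n : ℕ) :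
    (dirDeriv v)^[n] (f + c • h) = (dirDeriv v)^[n] f + c • (dirDeriv v)^[n] h := by
  induction n with
  | zero => rfl
  | succ n ih =>
    have h1 := iterate_dirDeriv_smooth hf v n
    have h2 := iterate_dirDeriv_smooth hh v n
    rw [Function.iterate_succ_apply', Function.iterate_succ_apply', Function.iterate_succ_apply',
      ih, dirDeriv_add h1 (show ContDiff ℝ ∞ (c • _) from h2.const_smul c), dirDeriv_smul h2]

theorem mixedDeriv_add_smul (hW : ContDiff ℝ ∞ W) (hw : ContDiff ℝ ∞ w) (c : ℝ) (i j : ℕ) :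
    mixedDeriv i j (W + c • w) = mixedDeriv i j W + c • mixedDeriv i j w := by
  rw [mixedDeriv, iterate_dirDeriv_add_smul hW hw, iterate_dirDeriv_add_smul
    (iterate_dirDeriv_smooth hW _ _) (iterate_dirDeriv_smooth hw _ _)]
  rfl

theorem tsupport_iterate_dirDeriv_subset {E : Type*} [NormedAddCommGroup E] [NormedSpace ℝ E]
    (v : E) (f : E → ℝ) (n : ℕ) : tsupport ((dirDeriv v)^[n] f) ⊆ tsupport f := by
  induction n with
  | zero => exact subset_rfl
  | succ n ih =>
    rw [Function.iterate_succ_apply']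
    exact (tsupport_dirDeriv_subset _ _).trans ih

theorem mixedDeriv_eq_zero_of_notMem {y : ℝ × ℝ} (hy : y ∉ tsupport w) (i j : ℕ) :
    mixedDeriv i j w y = 0 :=
  image_eq_zero_of_notMem_tsupport fun h => hy
    ((tsupport_iterate_dirDeriv_subset _ _ _).trans (tsupport_iterate_dirDeriv_subset _ _ _) h)

theorem hasDerivAt_fst_dirDeriv (hW : ContDiff ℝ ∞ W) (t x : ℝ) :
    HasDerivAt (fun s => W (s, x)) (dirDeriv (1, 0) W (t, x)) t := by
  simpa using hasDerivAt_dirDeriv_line hW (0, x) (1, 0) t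

theorem hasDerivAt_snd_dirDeriv (hW : ContDiff ℝ ∞ W) (t x : ℝ) :
    HasDerivAt (fun y => W (t, y)) (dirDeriv (0, 1) W (t, x)) x := by
  simpa using hasDerivAt_dirDeriv_line hW (t, 0) (0, 1) x

theorem pd_eq_mixedDeriv (hW : ContDiff ℝ ∞ W) (i j : ℕ) :
    pd i j (fun t x => W (t, x)) = fun t x => mixedDeriv i j W (t, x) := by
  have h1 : pdx^[j] (fun t x => W (t, x)) = fun t x => mixedDeriv 0 j W (t, x) := by
    induction j with
    | zero => rfl
    | succ j ih =>
      rw [Function.iterate_succ_apply', ih, ← dirDeriv_snd_mixedDeriv hW]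
      funext t x
      exact (hasDerivAt_snd_dirDeriv (hW.mixedDeriv 0 j) t x).deriv
  rw [pd, h1]
  induction i with
  | zero => rfl
  | succ i ih =>
    rw [Function.iterate_succ_apply', ih, ← dirDeriv_fst_mixedDeriv]
    funext t x
    exact (hasDerivAt_fst_dirDeriv (hW.mixedDeriv i j) t x).deriv

end MixedDeriv

/-- The function of five variables underlying `Λ`. -/
def uncurry5 (Λ : ℝ → ℝ → ℝ → ℝ → ℝ → ℝ) : ℝ × ℝ × ℝ × ℝ × ℝ → ℝ :=
  fun v => Λ v.1 v.2.1 v.2.2.1 v.2.2.2.1 v.2.2.2.2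

/-- The point `(x, u, u_x, u_xx, u_xxx)` of the `x`-jet of a function `W` on the plane. -/
def jetX (W : ℝ × ℝ → ℝ) (y : ℝ × ℝ) : ℝ × ℝ × ℝ × ℝ × ℝ :=
  (y.2, W y, mixedDeriv 0 1 W y, mixedDeriv 0 2 W y, mixedDeriv 0 3 W y)

theorem jetX_smooth {W : ℝ × ℝ → ℝ} (hW : ContDiff ℝ ∞ W) : ContDiff ℝ ∞ (jetX W) :=
  contDiff_snd.prodMk (hW.prodMk ((hW.mixedDeriv 0 1).prodMk
    ((hW.mixedDeriv 0 2).prodMk (hW.mixedDeriv 0 3))))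

/-- The Klein–Gordon expression `u_tx - g(u)`. -/
def kgExpr (g : ℝ → ℝ) (W : ℝ × ℝ → ℝ) : ℝ × ℝ → ℝ :=
  fun y => mixedDeriv 1 1 W y - g (W y)

theorem kgExpr_smooth {g : ℝ → ℝ} (hg : ContDiff ℝ ∞ g) {W : ℝ × ℝ → ℝ} (hW : ContDiff ℝ ∞ W) :
    ContDiff ℝ ∞ (kgExpr g W) :=
  (hW.mixedDeriv 1 1).sub (hg.comp hW)

/-- The first variation of `∬ (u_tx - g(u)) Λ` in the direction of a compactly supported `w`
vanishes when `Λ` is a multiplier. -/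
theorem integral_first_variation_eq_zero {g : ℝ → ℝ} (hg : ContDiff ℝ ∞ g)
    {Λ : ℝ → ℝ → ℝ → ℝ → ℝ → ℝ} (hΛ : Smooth5 Λ) (hm : IsMultiplierKG g Λ)
    {u w : ℝ × ℝ → ℝ} (hu : ContDiff ℝ ∞ u) (hw : ContDiff ℝ ∞ w) (hc : HasCompactSupport w) :
    ∫ y, ((mixedDeriv 1 1 w y - deriv g (u y) * w y) * uncurry5 Λ (jetX u y)
      + kgExpr g u y * fderiv ℝ (uncurry5 Λ) (jetX u y)
        (0, w y, mixedDeriv 0 1 w y, mixedDeriv 0 2 w y, mixedDeriv 0 3 w y)) = 0 := by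
  obtain ⟨Φt, Φx, hΦt, hΦx, hid⟩ := hm
  let J : ℝ × (ℝ × ℝ) → ℝ × ℝ × (JetIdx 4 → ℝ) := fun q =>
    (q.2.1, q.2.2, fun p => mixedDeriv p.1.1 p.1.2 u q.2 + q.1 * mixedDeriv p.1.1 p.1.2 w q.2)
  have hJ : ContDiff ℝ ∞ J := by
    refine (contDiff_fst.comp contDiff_snd).prodMk ((contDiff_snd.comp contDiff_snd).prodMk
      (contDiff_pi.2 fun p => ?_))
    exact ((hu.mixedDeriv _ _).comp contDiff_snd).add
      (contDiff_fst.mul ((hw.mixedDeriv _ _).comp contDiff_snd))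
  have main : ∀ (ε : ℝ) (y : ℝ × ℝ),
      (mixedDeriv 1 1 u y + ε * mixedDeriv 1 1 w y - g (u y + ε * w y)) *
        uncurry5 Λ (jetX u y + ε • (0, w y, mixedDeriv 0 1 w y, mixedDeriv 0 2 w y,
          mixedDeriv 0 3 w y)) =
      dirDeriv (0, (1, 0)) (Φt ∘ J) (ε, y) + dirDeriv (0, (0, 1)) (Φx ∘ J) (ε, y) := by
    rintro ε ⟨t, x⟩
    have hW : ContDiff ℝ ∞ (u + ε • w) := hu.add (contDiff_const.smul hw)
    have hjet : ∀ s y, (s, y, jet 4 (fun t x => (u + ε • w) (t, x)) s y) = J (ε, (s, y)) := by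
      intro s y
      refine congrArg (fun z => (s, y, z)) (funext fun p => ?_)
      simp only [jet, pd_eq_mixedDeriv hW, mixedDeriv_add_smul hu hw]
      rfl
    have h1 := hid (fun t x => (u + ε • w) (t, x)) hW t x
    simp only [pd_eq_mixedDeriv hW, mixedDeriv_add_smul hu hw, hjet] at h1
    have h2 := hasDerivAt_dirDeriv_line (hΦt.comp hJ) (ε, (0, x)) (0, (1, 0)) t
    have h3 := hasDerivAt_dirDeriv_line (hΦx.comp hJ) (ε, (t, 0)) (0, (0, 1)) x
    simp only [Prod.smul_mk, smul_eq_mul, mul_zero, mul_one, Prod.mk_add_mk, add_zero, zero_add,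
      Function.comp_apply] at h2 h3
    rw [h2.deriv, h3.deriv] at h1
    rw [← h1]
    simp [uncurry5, jetX]
  have hP : ∀ {Φ : ℝ × ℝ × (JetIdx 4 → ℝ) → ℝ}, ContDiff ℝ ∞ Φ → ∀ v : ℝ × ℝ,
      ∃ P : ℝ × ℝ → ℝ, ContDiff ℝ ∞ P ∧ HasCompactSupport P ∧
        ∀ y, HasDerivAt (fun ε => dirDeriv (0, v) (Φ ∘ J) (ε, y)) (dirDeriv v P y) 0 := by
    intro Φ hΦ v
    have hF := hΦ.comp hJ
    have hF0 := hF.dirDeriv (1, (0 : ℝ × ℝ))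
    have hP : ContDiff ℝ ∞ fun y : ℝ × ℝ => dirDeriv (1, (0 : ℝ × ℝ)) (Φ ∘ J) (0, y) :=
      hF0.comp (contDiff_const.prodMk contDiff_id)
    refine ⟨_, hP, ?_, fun y => ?_⟩
    · refine HasCompactSupport.intro hc fun y hy => dirDeriv_eq_zero_of_eq_on_line ?_ hF
      intro r
      simp [J, mixedDeriv_eq_zero_of_notMem hy]
    · have h1 := hasDerivAt_dirDeriv_line hP y v 0
      have h2 := hasDerivAt_dirDeriv_line hF0 (0, y) (0, v) 0
      simp only [Prod.smul_mk, smul_eq_mul, mul_zero, Prod.mk_add_mk, add_zero,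
        zero_smul] at h1 h2
      have h3 := hasDerivAt_dirDeriv_line (hF.dirDeriv (0, v)) (0, y) (1, (0 : ℝ × ℝ)) 0
      rw [h1.unique h2, dirDeriv_comm hF]
      simpa using h3
  obtain ⟨P, hPs, hPc, hPd⟩ := hP hΦt (1, 0)
  obtain ⟨Q, hQs, hQc, hQd⟩ := hP hΦx (0, 1)
  have hvar : ∀ y, ((mixedDeriv 1 1 w y - deriv g (u y) * w y) * uncurry5 Λ (jetX u y)
      + kgExpr g u y * fderiv ℝ (uncurry5 Λ) (jetX u y)
        (0, w y, mixedDeriv 0 1 w y, mixedDeriv 0 2 w y, mixedDeriv 0 3 w y)) =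
      dirDeriv (1, 0) P y + dirDeriv (0, 1) Q y := by
    intro y
    have h1 := (hPd y).add (hQd y)
    have h2 := hasDerivAt_dirDeriv_line (f := uncurry5 Λ) hΛ (jetX u y)
      (0, w y, mixedDeriv 0 1 w y, mixedDeriv 0 2 w y, mixedDeriv 0 3 w y) 0
    have h3 : ∀ a b : ℝ, HasDerivAt (fun ε : ℝ => a + ε * b) b 0 := fun a b => by
      simpa using ((hasDerivAt_id (0 : ℝ)).mul_const b).const_add a
    have h4 : HasDerivAt g (deriv g (u y)) (u y + 0 * w y) := by
      simpa using (hg.differentiable (by simp) (u y)).hasDerivAt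
    have h5 := (((h3 (mixedDeriv 1 1 u y) (mixedDeriv 1 1 w y)).sub
      (h4.comp 0 (h3 (u y) (w y)))).mul h2)
    have h6 := h5.unique (h1.congr_of_eventuallyEq (Filter.Eventually.of_forall fun ε => main ε y))
    rw [← h6]
    simp [kgExpr, dirDeriv]
  simp_rw [hvar]
  rw [integral_add, integral_dirDeriv_eq_zero hPs hPc, integral_dirDeriv_eq_zero hQs hQc, add_zero]
  · exact (hPs.dirDeriv _).continuous.integrable_of_hasCompactSupport (hPc.dirDeriv _)
  · exact (hQs.dirDeriv _).continuous.integrable_of_hasCompactSupport (hQc.dirDeriv _)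

theorem map_five (L : ℝ × ℝ × ℝ × ℝ × ℝ →L[ℝ] ℝ) (k a b c d : ℝ) :
    L (k, a, b, c, d) = k * L (1, 0, 0, 0, 0) + a * L (0, 1, 0, 0, 0) + b * L (0, 0, 1, 0, 0)
      + c * L (0, 0, 0, 1, 0) + d * L (0, 0, 0, 0, 1) := by
  have : ((k, a, b, c, d) : ℝ × ℝ × ℝ × ℝ × ℝ) = k • (1, 0, 0, 0, 0) + a • (0, 1, 0, 0, 0)
      + b • (0, 0, 1, 0, 0) + c • (0, 0, 0, 1, 0) + d • (0, 0, 0, 0, 1) := by simp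
  rw [this]
  simp only [map_add, map_smul, smul_eq_mul]

theorem integral_six {α : Type*} [MeasurableSpace α] {μ : Measure α} {a b c d e f : α → ℝ}
    (ha : Integrable a μ) (hb : Integrable b μ) (hc : Integrable c μ) (hd : Integrable d μ)
    (he : Integrable e μ) (hf : Integrable f μ) :
    ∫ y, (a y - b y + c y + d y + e y + f y) ∂μ =
      ∫ y, a y ∂μ - ∫ y, b y ∂μ + ∫ y, c y ∂μ + ∫ y, d y ∂μ + ∫ y, e y ∂μ + ∫ y, f y ∂μ := by
  have h1 := integral_add' ((((ha.sub hb).add hc).add hd).add he) hf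
  rw [integral_add' (((ha.sub hb).add hc).add hd) he, integral_add' ((ha.sub hb).add hc) hd,
    integral_add' (ha.sub hb) hc, integral_sub' ha hb] at h1
  exact h1

/-- The Euler–Lagrange equation of `(u_tx - g(u)) Λ` holds identically when `Λ` is a multiplier. -/
theorem euler_eq_zero {g : ℝ → ℝ} (hg : ContDiff ℝ ∞ g)
    {Λ : ℝ → ℝ → ℝ → ℝ → ℝ → ℝ} (hΛ : Smooth5 Λ) (hm : IsMultiplierKG g Λ)
    {u : ℝ × ℝ → ℝ} (hu : ContDiff ℝ ∞ u) :
    dirDeriv (0, 1) (dirDeriv (1, 0) (uncurry5 Λ ∘ jetX u))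
      - (deriv g ∘ u) * (uncurry5 Λ ∘ jetX u)
      + kgExpr g u * (dirDeriv (0, 1, 0, 0, 0) (uncurry5 Λ) ∘ jetX u)
      - dirDeriv (0, 1) (kgExpr g u * (dirDeriv (0, 0, 1, 0, 0) (uncurry5 Λ) ∘ jetX u))
      + dirDeriv (0, 1) (dirDeriv (0, 1)
          (kgExpr g u * (dirDeriv (0, 0, 0, 1, 0) (uncurry5 Λ) ∘ jetX u)))
      - dirDeriv (0, 1) (dirDeriv (0, 1) (dirDeriv (0, 1)
          (kgExpr g u * (dirDeriv (0, 0, 0, 0, 1) (uncurry5 Λ) ∘ jetX u)))) = 0 := by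
  have hF : ContDiff ℝ ∞ (uncurry5 Λ) := hΛ
  have hz := jetX_smooth hu
  have hG := kgExpr_smooth hg hu
  have h0 : ContDiff ℝ ∞ (uncurry5 Λ ∘ jetX u) := hF.comp hz
  have hd : ContDiff ℝ ∞ ((deriv g ∘ u) * (uncurry5 Λ ∘ jetX u)) :=
    ((contDiff_infty_iff_deriv.1 hg).2.comp hu).mul h0
  have hA : ∀ v, ContDiff ℝ ∞ (kgExpr g u * (dirDeriv v (uncurry5 Λ) ∘ jetX u)) := fun v =>
    hG.mul ((hF.dirDeriv v).comp hz)
  set A0 := kgExpr g u * (dirDeriv (0, 1, 0, 0, 0) (uncurry5 Λ) ∘ jetX u) with hA0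
  set A1 := kgExpr g u * (dirDeriv (0, 0, 1, 0, 0) (uncurry5 Λ) ∘ jetX u) with hA1
  set A2 := kgExpr g u * (dirDeriv (0, 0, 0, 1, 0) (uncurry5 Λ) ∘ jetX u) with hA2
  set A3 := kgExpr g u * (dirDeriv (0, 0, 0, 0, 1) (uncurry5 Λ) ∘ jetX u) with hA3
  have s0 : ContDiff ℝ ∞ A0 := hA _
  have s1 : ContDiff ℝ ∞ A1 := hA _
  have s2 : ContDiff ℝ ∞ A2 := hA _
  have s3 : ContDiff ℝ ∞ A3 := hA _
  refine eq_zero_of_integral_mul_eq_zero (μ := volume) ?_ fun w hw hc => ?_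
  · exact (((((h0.dirDeriv _).dirDeriv _).sub hd).add s0).sub (s1.dirDeriv _)).add
      ((s2.dirDeriv _).dirDeriv _) |>.sub (((s3.dirDeriv _).dirDeriv _).dirDeriv _)
  have hvar := integral_first_variation_eq_zero hg hΛ hm hu hw hc
  have hwx := hw.dirDeriv (0, 1)
  have hcx := hc.dirDeriv (0, 1)
  have hwxx := hwx.dirDeriv (0, 1)
  have hcxx := hcx.dirDeriv (0, 1)
  have e1 : ∀ y, (mixedDeriv 1 1 w y - deriv g (u y) * w y) * uncurry5 Λ (jetX u y)
      + kgExpr g u y * fderiv ℝ (uncurry5 Λ) (jetX u y)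
        (0, w y, mixedDeriv 0 1 w y, mixedDeriv 0 2 w y, mixedDeriv 0 3 w y) =
      dirDeriv (1, 0) (dirDeriv (0, 1) w) y * (uncurry5 Λ ∘ jetX u) y
      - w y * ((deriv g ∘ u) * (uncurry5 Λ ∘ jetX u)) y + w y * A0 y
      + dirDeriv (0, 1) w y * A1 y + dirDeriv (0, 1) (dirDeriv (0, 1) w) y * A2 y
      + dirDeriv (0, 1) (dirDeriv (0, 1) (dirDeriv (0, 1) w)) y * A3 y := by
    intro y
    rw [map_five]
    simp only [hA0, hA1, hA2, hA3, Pi.mul_apply, Function.comp_apply, mixedDeriv,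
      Function.iterate_succ_apply', Function.iterate_zero, id]
    simp only [dirDeriv]
    ring
  simp_rw [e1] at hvar
  have i1 := integrable_mul_of_hasCompactSupport (μ := volume)
    (hwx.dirDeriv (1, 0)) (hcx.dirDeriv (1, 0)) h0
  have i2 := integrable_mul_of_hasCompactSupport (μ := volume) hw hc hd
  have i3 := integrable_mul_of_hasCompactSupport (μ := volume) hw hc s0
  have i4 := integrable_mul_of_hasCompactSupport (μ := volume) hwx hcx s1
  have i5 := integrable_mul_of_hasCompactSupport (μ := volume) hwxx hcxx s2
  have i6 := integrable_mul_of_hasCompactSupport (μ := volume)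
    (hwxx.dirDeriv (0, 1)) (hcxx.dirDeriv (0, 1)) s3
  rw [integral_six i1 i2 i3 i4 i5 i6,
    integral_dirDeriv_mul hwx hcx h0, integral_dirDeriv_mul hw hc (h0.dirDeriv _),
    integral_dirDeriv_mul hw hc s1, integral_dirDeriv_mul hwx hcx s2,
    integral_dirDeriv_mul hw hc (s2.dirDeriv _), integral_dirDeriv_mul hwxx hcxx s3,
    integral_dirDeriv_mul hwx hcx (s3.dirDeriv _),
    integral_dirDeriv_mul hw hc ((s3.dirDeriv _).dirDeriv _)] at hvar
  have j1 := integrable_mul_of_hasCompactSupport (μ := volume) hw hc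
    ((h0.dirDeriv (1, 0)).dirDeriv (0, 1))
  have j4 := integrable_mul_of_hasCompactSupport (μ := volume) hw hc (s1.dirDeriv (0, 1))
  have j5 := integrable_mul_of_hasCompactSupport (μ := volume) hw hc
    ((s2.dirDeriv (0, 1)).dirDeriv (0, 1))
  have j6 := integrable_mul_of_hasCompactSupport (μ := volume) hw hc
    (((s3.dirDeriv (0, 1)).dirDeriv (0, 1)).dirDeriv (0, 1))
  simp only [Pi.add_apply, Pi.sub_apply, mul_add, mul_sub]
  have hsum := integral_six j1 i2 i3 j4.neg j5 j6.neg
  simp only [Pi.neg_apply, integral_neg, ← sub_eq_add_neg] at hsum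
  rw [hsum]
  linarith

theorem dirDeriv_one_apply {f : ℝ → ℝ} (x : ℝ) : dirDeriv 1 f x = deriv f x := by
  simp [dirDeriv]

theorem hasDerivAt_dirDeriv_one {f : ℝ → ℝ} (hf : ContDiff ℝ ∞ f) (x : ℝ) :
    HasDerivAt f (dirDeriv 1 f x) x := by
  rw [dirDeriv_one_apply]
  exact (hf.differentiable (by simp) x).hasDerivAt

/-- The point `(x, U, U', U'', U''')` of the jet of a function `U` of one variable. -/
def jetLine (U : ℝ → ℝ) (x : ℝ) : ℝ × ℝ × ℝ × ℝ × ℝ :=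
  (x, U x, dirDeriv 1 U x, dirDeriv 1 (dirDeriv 1 U) x, dirDeriv 1 (dirDeriv 1 (dirDeriv 1 U)) x)

theorem jetLine_smooth {U : ℝ → ℝ} (hU : ContDiff ℝ ∞ U) : ContDiff ℝ ∞ (jetLine U) :=
  contDiff_id.prodMk (hU.prodMk ((hU.dirDeriv 1).prodMk
    (((hU.dirDeriv 1).dirDeriv 1).prodMk (((hU.dirDeriv 1).dirDeriv 1).dirDeriv 1))))

/-- The function `U(x) + t V(x)` on the plane. -/
def affineInTime (U V : ℝ → ℝ) : ℝ × ℝ → ℝ := fun y => U y.2 + y.1 * V y.2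

section AffineInTime

variable {U V : ℝ → ℝ}

theorem affineInTime_smooth (hU : ContDiff ℝ ∞ U) (hV : ContDiff ℝ ∞ V) :
    ContDiff ℝ ∞ (affineInTime U V) :=
  (hU.comp contDiff_snd).add (contDiff_fst.mul (hV.comp contDiff_snd))

theorem dirDeriv_snd_affineInTime (hU : ContDiff ℝ ∞ U) (hV : ContDiff ℝ ∞ V) :
    dirDeriv (0, 1) (affineInTime U V) = affineInTime (dirDeriv 1 U) (dirDeriv 1 V) := by
  funext ⟨t, x⟩
  refine (hasDerivAt_snd_dirDeriv (affineInTime_smooth hU hV) t x).unique ?_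
  exact (hasDerivAt_dirDeriv_one hU x).add ((hasDerivAt_dirDeriv_one hV x).const_mul t)

theorem dirDeriv_fst_affineInTime (hU : ContDiff ℝ ∞ U) (hV : ContDiff ℝ ∞ V) :
    dirDeriv (1, 0) (affineInTime U V) = fun y => V y.2 := by
  funext ⟨t, x⟩
  refine (hasDerivAt_fst_dirDeriv (affineInTime_smooth hU hV) t x).unique ?_
  simpa [affineInTime] using ((hasDerivAt_id t).mul_const (V x)).const_add (U x)

theorem jetX_affineInTime (hU : ContDiff ℝ ∞ U) (hV : ContDiff ℝ ∞ V) (t x : ℝ) :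
    jetX (affineInTime U V) (t, x) = jetLine U x + t • (0, V x, dirDeriv 1 V x,
      dirDeriv 1 (dirDeriv 1 V) x, dirDeriv 1 (dirDeriv 1 (dirDeriv 1 V)) x) := by
  have hU1 := hU.dirDeriv 1
  have hV1 := hV.dirDeriv 1
  have hU2 := hU1.dirDeriv 1
  have hV2 := hV1.dirDeriv 1
  simp [jetX, mixedDeriv, jetLine, dirDeriv_snd_affineInTime, affineInTime, *]

end AffineInTime

/-- The restriction of a function on the plane to the line `t = 0`. -/
def atTimeZero (h : ℝ × ℝ → ℝ) : ℝ → ℝ := fun x => h (0, x)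

theorem atTimeZero_dirDeriv {h : ℝ × ℝ → ℝ} (hh : ContDiff ℝ ∞ h) :
    atTimeZero (dirDeriv (0, 1) h) = dirDeriv 1 (atTimeZero h) := by
  funext x
  rw [dirDeriv_one_apply]
  exact (hasDerivAt_snd_dirDeriv hh 0 x).deriv.symm

/-- The Euler–Lagrange equation along `t = 0` for the functions `U(x) + t V(x)`. -/
theorem euler_affineInTime {g : ℝ → ℝ} (hg : ContDiff ℝ ∞ g)
    {Λ : ℝ → ℝ → ℝ → ℝ → ℝ → ℝ} (hΛ : Smooth5 Λ) (hm : IsMultiplierKG g Λ)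
    {U V : ℝ → ℝ} (hU : ContDiff ℝ ∞ U) (hV : ContDiff ℝ ∞ V) :
    dirDeriv 1 ((dirDeriv (0, 1, 0, 0, 0) (uncurry5 Λ) ∘ jetLine U) * V
        + (dirDeriv (0, 0, 1, 0, 0) (uncurry5 Λ) ∘ jetLine U) * dirDeriv 1 V
        + (dirDeriv (0, 0, 0, 1, 0) (uncurry5 Λ) ∘ jetLine U) * dirDeriv 1 (dirDeriv 1 V)
        + (dirDeriv (0, 0, 0, 0, 1) (uncurry5 Λ) ∘ jetLine U) *
          dirDeriv 1 (dirDeriv 1 (dirDeriv 1 V)))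
      - (deriv g ∘ U) * (uncurry5 Λ ∘ jetLine U)
      + (dirDeriv 1 V - g ∘ U) * (dirDeriv (0, 1, 0, 0, 0) (uncurry5 Λ) ∘ jetLine U)
      - dirDeriv 1 ((dirDeriv 1 V - g ∘ U) *
          (dirDeriv (0, 0, 1, 0, 0) (uncurry5 Λ) ∘ jetLine U))
      + dirDeriv 1 (dirDeriv 1 ((dirDeriv 1 V - g ∘ U) *
          (dirDeriv (0, 0, 0, 1, 0) (uncurry5 Λ) ∘ jetLine U)))
      - dirDeriv 1 (dirDeriv 1 (dirDeriv 1 ((dirDeriv 1 V - g ∘ U) *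
          (dirDeriv (0, 0, 0, 0, 1) (uncurry5 Λ) ∘ jetLine U)))) = 0 := by
  have hF : ContDiff ℝ ∞ (uncurry5 Λ) := hΛ
  have hu := affineInTime_smooth hU hV
  have hz := jetX_smooth hu
  have hG := kgExpr_smooth hg hu
  have hA : ∀ v, ContDiff ℝ ∞
      (kgExpr g (affineInTime U V) * (dirDeriv v (uncurry5 Λ) ∘ jetX (affineInTime U V))) :=
    fun v => hG.mul ((hF.dirDeriv v).comp hz)
  have r0 : ∀ f : ℝ × ℝ × ℝ × ℝ × ℝ → ℝ,
      atTimeZero (f ∘ jetX (affineInTime U V)) = f ∘ jetLine U := by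
    intro f
    funext x
    simp [atTimeZero, jetX_affineInTime hU hV]
  have r1 : atTimeZero (kgExpr g (affineInTime U V)) = dirDeriv 1 V - g ∘ U := by
    funext x
    simp [atTimeZero, kgExpr, mixedDeriv, dirDeriv_snd_affineInTime hU hV,
      dirDeriv_fst_affineInTime (hU.dirDeriv 1) (hV.dirDeriv 1), affineInTime]
  have r2 : ∀ v, atTimeZero
      (kgExpr g (affineInTime U V) * (dirDeriv v (uncurry5 Λ) ∘ jetX (affineInTime U V))) =
      (dirDeriv 1 V - g ∘ U) * (dirDeriv v (uncurry5 Λ) ∘ jetLine U) := by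
    intro v
    rw [← r1, ← r0]
    rfl
  have r3 : atTimeZero ((deriv g ∘ affineInTime U V) * (uncurry5 Λ ∘ jetX (affineInTime U V))) =
      (deriv g ∘ U) * (uncurry5 Λ ∘ jetLine U) := by
    rw [← r0]
    funext x
    simp [atTimeZero, affineInTime]
  have r4 : atTimeZero (dirDeriv (1, 0) (uncurry5 Λ ∘ jetX (affineInTime U V))) =
      (dirDeriv (0, 1, 0, 0, 0) (uncurry5 Λ) ∘ jetLine U) * V
        + (dirDeriv (0, 0, 1, 0, 0) (uncurry5 Λ) ∘ jetLine U) * dirDeriv 1 V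
        + (dirDeriv (0, 0, 0, 1, 0) (uncurry5 Λ) ∘ jetLine U) * dirDeriv 1 (dirDeriv 1 V)
        + (dirDeriv (0, 0, 0, 0, 1) (uncurry5 Λ) ∘ jetLine U) *
          dirDeriv 1 (dirDeriv 1 (dirDeriv 1 V)) := by
    funext x
    have h1 := hasDerivAt_fst_dirDeriv (hF.comp hz) 0 x
    simp only [Function.comp_apply, jetX_affineInTime hU hV] at h1
    refine (h1.unique (hasDerivAt_dirDeriv_line hF _ _ 0)).trans ?_
    rw [zero_smul, add_zero, dirDeriv, map_five]
    simp only [Pi.add_apply, Pi.mul_apply, Function.comp_apply, dirDeriv]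
    ring
  rw [← r4, ← r3, ← r2, ← r2, ← r2, ← r2, ← atTimeZero_dirDeriv ((hF.comp hz).dirDeriv _),
    ← atTimeZero_dirDeriv (hA _), ← atTimeZero_dirDeriv (hA _), ← atTimeZero_dirDeriv (hA _),
    ← atTimeZero_dirDeriv ((hA _).dirDeriv _), ← atTimeZero_dirDeriv ((hA _).dirDeriv _),
    ← atTimeZero_dirDeriv (((hA _).dirDeriv _).dirDeriv _)]
  exact congrArg atTimeZero (euler_eq_zero hg hΛ hm hu)

/-- The quartic polynomial with prescribed derivatives at `x`. -/
def taylorQuartic (x v p q r s : ℝ) : ℝ → ℝ := fun y =>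
  v + p * (y - x) + q / 2 * (y - x) ^ 2 + r / 6 * (y - x) ^ 3 + s / 24 * (y - x) ^ 4

theorem taylorQuartic_self (x v p q r s : ℝ) : taylorQuartic x v p q r s x = v := by
  simp [taylorQuartic]

theorem taylorQuartic_smooth (x v p q r s : ℝ) : ContDiff ℝ ∞ (taylorQuartic x v p q r s) := by
  unfold taylorQuartic
  fun_prop

theorem dirDeriv_taylorQuartic (x v p q r s : ℝ) :
    dirDeriv 1 (taylorQuartic x v p q r s) = taylorQuartic x p q r s 0 := by
  funext y
  refine (hasDerivAt_dirDeriv_one (taylorQuartic_smooth x v p q r s) y).unique ?_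
  have h1 : HasDerivAt (fun y => y - x) 1 y := (hasDerivAt_id y).sub_const x
  refine (((((h1.const_mul p).const_add v).add ((h1.pow 2).const_mul (q / 2))).add
    ((h1.pow 3).const_mul (r / 6))).add ((h1.pow 4).const_mul (s / 24))).congr_deriv ?_
  simp [taylorQuartic]
  ring

/-- The differential consequences of an Euler–Lagrange operator vanishing on all functions `V`. -/
theorem coefficients_of_euler {A0 A1 A2 A3 B Γ : ℝ → ℝ} (h0 : ContDiff ℝ ∞ A0)
    (h1 : ContDiff ℝ ∞ A1) (h2 : ContDiff ℝ ∞ A2) (h3 : ContDiff ℝ ∞ A3) (hΓ : ContDiff ℝ ∞ Γ)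
    (H : ∀ V : ℝ → ℝ, ContDiff ℝ ∞ V →
      dirDeriv 1 (A0 * V + A1 * dirDeriv 1 V + A2 * dirDeriv 1 (dirDeriv 1 V)
        + A3 * dirDeriv 1 (dirDeriv 1 (dirDeriv 1 V))) - B + (dirDeriv 1 V - Γ) * A0
        - dirDeriv 1 ((dirDeriv 1 V - Γ) * A1)
        + dirDeriv 1 (dirDeriv 1 ((dirDeriv 1 V - Γ) * A2))
        - dirDeriv 1 (dirDeriv 1 (dirDeriv 1 ((dirDeriv 1 V - Γ) * A3))) = 0) :
    A0 = 0 ∧ A2 = dirDeriv 1 A3 ∧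
      B = dirDeriv 1 (Γ * A1) + dirDeriv 1 (dirDeriv 1 (dirDeriv 1 Γ * A3)) := by
  have hΓ1 := hΓ.dirDeriv 1
  have h31 := h3.dirDeriv 1
  have exp : ∀ V : ℝ → ℝ, ContDiff ℝ ∞ V →
      dirDeriv 1 A0 * V + 2 * A0 * dirDeriv 1 V
        + 3 * (dirDeriv 1 A2 - dirDeriv 1 (dirDeriv 1 A3)) * dirDeriv 1 (dirDeriv 1 V)
        + 2 * (A2 - dirDeriv 1 A3) * dirDeriv 1 (dirDeriv 1 (dirDeriv 1 V))
        + (dirDeriv 1 (dirDeriv 1 A2) - dirDeriv 1 (dirDeriv 1 (dirDeriv 1 A3))) * dirDeriv 1 V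
        - B - Γ * A0 + dirDeriv 1 (Γ * A1) - dirDeriv 1 (dirDeriv 1 (Γ * A2))
        + dirDeriv 1 (dirDeriv 1 (dirDeriv 1 (Γ * A3))) = 0 := by
    intro V hV
    rw [← H V hV]
    simp (disch := repeat' first
      | assumption
      | apply ContDiff.dirDeriv
      | apply contDiff_funAdd
      | apply contDiff_funSub
      | apply contDiff_funMul) only [dirDeriv_add, dirDeriv_sub, dirDeriv_mul]
    ring
  have expAt : ∀ x p r : ℝ, 2 * A0 x * p + 2 * (A2 x - dirDeriv 1 A3 x) * r
        + (dirDeriv 1 (dirDeriv 1 A2) x - dirDeriv 1 (dirDeriv 1 (dirDeriv 1 A3)) x) * p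
        - B x - Γ x * A0 x + dirDeriv 1 (Γ * A1) x - dirDeriv 1 (dirDeriv 1 (Γ * A2)) x
        + dirDeriv 1 (dirDeriv 1 (dirDeriv 1 (Γ * A3))) x = 0 := by
    intro x p r
    have h := congrFun (exp _ (taylorQuartic_smooth x 0 p 0 r 0)) x
    simpa [dirDeriv_taylorQuartic, taylorQuartic_self] using h
  have hM : A2 = dirDeriv 1 A3 := by
    funext x
    linarith [expAt x 0 0, expAt x 0 1]
  have hA0 : A0 = 0 := by
    funext x
    have h3 := expAt x 1 0
    have h4 := expAt x 0 0
    simp only [hM] at h3 h4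
    simp only [Pi.zero_apply]
    linarith
  refine ⟨hA0, hM, ?_⟩
  have hsum : dirDeriv 1 (dirDeriv 1 (Γ * A3)) =
      dirDeriv 1 (dirDeriv 1 Γ * A3) + dirDeriv 1 (Γ * A2) := by
    rw [hM, dirDeriv_mul hΓ h3, dirDeriv_add (contDiff_funMul hΓ1 h3) (contDiff_funMul hΓ h31)]
  funext x
  have h5 := expAt x 0 0
  rw [hsum, dirDeriv_add ((contDiff_funMul hΓ1 h3).dirDeriv 1)
    ((contDiff_funMul hΓ h2).dirDeriv 1), hA0] at h5
  simp only [Pi.add_apply, Pi.zero_apply] at h5 ⊢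
  linarith

/-- The determining equations of a multiplier, at an arbitrary point of the jet space. -/
theorem determining_equations {g : ℝ → ℝ} (hg : ContDiff ℝ ∞ g)
    {Λ : ℝ → ℝ → ℝ → ℝ → ℝ → ℝ} (hΛ : Smooth5 Λ) (hm : IsMultiplierKG g Λ)
    {F A B C : ℝ × ℝ × ℝ × ℝ × ℝ → ℝ} (hF : F = uncurry5 Λ)
    (hA : A = dirDeriv (0, 0, 0, 0, 1) F) (hB : B = dirDeriv (0, 0, 0, 1, 0) F)
    (hC : C = dirDeriv (0, 0, 1, 0, 0) F) (x v p q r s : ℝ) :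
    dirDeriv (0, 1, 0, 0, 0) F (x, v, p, q, r) = 0 ∧
    B (x, v, p, q, r) = dirDeriv (1, p, q, r, s) A (x, v, p, q, r) ∧
    p ^ 3 * A (x, v, p, q, r) * deriv (deriv (deriv g)) v
      + (3 * p * q * A (x, v, p, q, r) + 2 * p ^ 2 * B (x, v, p, q, r)) * deriv (deriv g) v
      + (r * A (x, v, p, q, r) + 2 * q * B (x, v, p, q, r)
        + p * dirDeriv (1, p, q, r, s) B (x, v, p, q, r) + p * C (x, v, p, q, r)
        - F (x, v, p, q, r)) * deriv g v
      + dirDeriv (1, p, q, r, s) C (x, v, p, q, r) * g v = 0 := by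
  have sF : ContDiff ℝ ∞ F := hF ▸ hΛ
  have sA : ContDiff ℝ ∞ A := hA ▸ sF.dirDeriv _
  have sB : ContDiff ℝ ∞ B := hB ▸ sF.dirDeriv _
  have sC : ContDiff ℝ ∞ C := hC ▸ sF.dirDeriv _
  set U := taylorQuartic x v p q r s with hUdef
  have hU : ContDiff ℝ ∞ U := taylorQuartic_smooth x v p q r s
  have hj : ContDiff ℝ ∞ (jetLine U) := jetLine_smooth hU
  have hjx : jetLine U x = (x, v, p, q, r) := by
    simp [jetLine, hUdef, dirDeriv_taylorQuartic, taylorQuartic_self]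
  have hjd : HasDerivAt (jetLine U) (1, p, q, r, s) x := by
    have h : HasDerivAt (jetLine U) _ x :=
      (hasDerivAt_id x).prodMk ((hasDerivAt_dirDeriv_one hU x).prodMk
      ((hasDerivAt_dirDeriv_one (hU.dirDeriv 1) x).prodMk
      ((hasDerivAt_dirDeriv_one ((hU.dirDeriv 1).dirDeriv 1) x).prodMk
      (hasDerivAt_dirDeriv_one (((hU.dirDeriv 1).dirDeriv 1).dirDeriv 1) x))))
    simpa only [hUdef, dirDeriv_taylorQuartic, taylorQuartic_self] using h
  have chain : ∀ {K : ℝ × ℝ × ℝ × ℝ × ℝ → ℝ}, ContDiff ℝ ∞ K →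
      dirDeriv 1 (K ∘ jetLine U) x = dirDeriv (1, p, q, r, s) K (x, v, p, q, r) := by
    intro K hK
    have h := (hK.hasFDerivAt_infty (jetLine U x)).comp_hasDerivAt x hjd
    rw [hjx] at h
    exact (hasDerivAt_dirDeriv_one (hK.comp hj) x).unique h
  obtain ⟨e1, e2, e3⟩ := coefficients_of_euler ((sF.dirDeriv (0, 1, 0, 0, 0)).comp hj)
    (sC.comp hj) (sB.comp hj) (sA.comp hj) (hg.comp hU)
    (B := (deriv g ∘ U) * (F ∘ jetLine U)) (fun V hV => by
      subst hA hB hC hF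
      exact euler_affineInTime hg hΛ hm hU hV)
  have dg : ContDiff ℝ ∞ (deriv g) := (contDiff_infty_iff_deriv.1 hg).2
  have ddg : ContDiff ℝ ∞ (deriv (deriv g)) := (contDiff_infty_iff_deriv.1 dg).2
  have chainU : ∀ {k : ℝ → ℝ}, ContDiff ℝ ∞ k →
      dirDeriv 1 (k ∘ U) = (deriv k ∘ U) * dirDeriv 1 U := by
    intro k hk
    funext y
    refine (hasDerivAt_dirDeriv_one (hk.comp hU) y).unique ?_
    exact ((hk.differentiable (by simp) (U y)).hasDerivAt).comp y (hasDerivAt_dirDeriv_one hU y)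
  have sAj : ContDiff ℝ ∞ (A ∘ jetLine U) := sA.comp hj
  have sBj : ContDiff ℝ ∞ (B ∘ jetLine U) := sB.comp hj
  have sCj : ContDiff ℝ ∞ (C ∘ jetLine U) := sC.comp hj
  have sg : ContDiff ℝ ∞ (g ∘ U) := hg.comp hU
  have sg1 : ContDiff ℝ ∞ (deriv g ∘ U) := dg.comp hU
  have sg2 : ContDiff ℝ ∞ (deriv (deriv g) ∘ U) := ddg.comp hU
  refine ⟨?_, ?_, ?_⟩
  · simpa [hjx] using congrFun e1 x
  · rw [← chain sA, ← e2, Function.comp_apply, hjx]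
  · have e4 := congrFun e3 x
    rw [chainU hg] at e4
    simp (disch := repeat' first
      | assumption
      | apply ContDiff.dirDeriv
      | apply contDiff_funAdd
      | apply contDiff_funMul) only [dirDeriv_add, dirDeriv_mul, chainU, ← e2] at e4
    simp only [Pi.add_apply, Pi.mul_apply, Function.comp_apply, chain sC, chain sB, hjx] at e4
    simp only [hUdef, dirDeriv_taylorQuartic, taylorQuartic_self] at e4
    linarith

theorem apply_add_smul_of_dirDeriv_eq_zero {E : Type*} [NormedAddCommGroup E] [NormedSpace ℝ E]
    {f : E → ℝ} {v : E} (hf : ContDiff ℝ ∞ f) (h : dirDeriv v f = 0) (y : E) (s : ℝ) :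
    f (y + s • v) = f y := by
  have h1 : ∀ r : ℝ, HasDerivAt (fun r : ℝ => f (y + r • v)) 0 r := fun r => by
    simpa [h] using hasDerivAt_dirDeriv_line hf y v r
  simpa using is_const_of_deriv_eq_zero (fun r => (h1 r).differentiableAt)
    (fun r => (h1 r).deriv) s 0

theorem dirDeriv_dirDeriv_eq_zero {E : Type*} [NormedAddCommGroup E] [NormedSpace ℝ E]
    {f : E → ℝ} {v : E} (hf : ContDiff ℝ ∞ f) (h : dirDeriv v f = 0) (w : E) :
    dirDeriv v (dirDeriv w f) = 0 := by
  rw [dirDeriv_comm hf, h]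
  funext y
  simp [dirDeriv, fderiv_zero]

theorem apply_add_smul_of_dirDeriv_dirDeriv_eq_zero {E : Type*} [NormedAddCommGroup E]
    [NormedSpace ℝ E] {f : E → ℝ} {v : E} (hf : ContDiff ℝ ∞ f)
    (h : dirDeriv v (dirDeriv v f) = 0) (y : E) : f (y + v) = f y + dirDeriv v f y := by
  have h1 : ∀ r : ℝ, HasDerivAt (fun r : ℝ => f (y + r • v) - r * dirDeriv v f y) 0 r :=
    fun r => by
      have h2 : HasDerivAt (fun r : ℝ => f (y + r • v) - r * dirDeriv v f y) _ r :=
        (hasDerivAt_dirDeriv_line hf y v r).sub ((hasDerivAt_id r).mul_const (dirDeriv v f y))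
      rw [apply_add_smul_of_dirDeriv_eq_zero (hf.dirDeriv v) h y r] at h2
      simpa using h2
  have h3 := is_const_of_deriv_eq_zero (fun r => (h1 r).differentiableAt)
    (fun r => (h1 r).deriv) 1 0
  simp only [one_smul, one_mul, zero_smul, add_zero, zero_mul, sub_zero] at h3
  linarith

theorem dirDeriv_five (K : ℝ × ℝ × ℝ × ℝ × ℝ → ℝ) (k a b c d : ℝ) (z : ℝ × ℝ × ℝ × ℝ × ℝ) :
    dirDeriv (k, a, b, c, d) K z = k * dirDeriv (1, 0, 0, 0, 0) K z
      + a * dirDeriv (0, 1, 0, 0, 0) K z + b * dirDeriv (0, 0, 1, 0, 0) K z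
      + c * dirDeriv (0, 0, 0, 1, 0) K z + d * dirDeriv (0, 0, 0, 0, 1) K z :=
  map_five _ k a b c d

section Coordinates

variable {h : ℝ × ℝ × ℝ × ℝ × ℝ → ℝ}

theorem eq_of_dirDeriv_u_eq_zero (hh : ContDiff ℝ ∞ h)
    (hd : dirDeriv (0, 1, 0, 0, 0) h = 0) (x v p q r : ℝ) :
    h (x, v, p, q, r) = h (x, 0, p, q, r) := by
  simpa using apply_add_smul_of_dirDeriv_eq_zero hh hd (x, 0, p, q, r) v

theorem eq_of_dirDeriv_p_eq_zero (hh : ContDiff ℝ ∞ h)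
    (hd : dirDeriv (0, 0, 1, 0, 0) h = 0) (x v p q r : ℝ) :
    h (x, v, p, q, r) = h (x, v, 0, q, r) := by
  simpa using apply_add_smul_of_dirDeriv_eq_zero hh hd (x, v, 0, q, r) p

theorem eq_of_dirDeriv_q_eq_zero (hh : ContDiff ℝ ∞ h)
    (hd : dirDeriv (0, 0, 0, 1, 0) h = 0) (x v p q r : ℝ) :
    h (x, v, p, q, r) = h (x, v, p, 0, r) := by
  simpa using apply_add_smul_of_dirDeriv_eq_zero hh hd (x, v, p, 0, r) q

theorem eq_of_dirDeriv_r_eq_zero (hh : ContDiff ℝ ∞ h)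
    (hd : dirDeriv (0, 0, 0, 0, 1) h = 0) (x v p q r : ℝ) :
    h (x, v, p, q, r) = h (x, v, p, q, 0) := by
  simpa using apply_add_smul_of_dirDeriv_eq_zero hh hd (x, v, p, q, 0) r

end Coordinates

/-- If `g` and `g'` are linearly independent, a multiplier depending effectively on `u_xxx` forces
`g` to be an eigenfunction of the second derivative. -/
theorem exists_deriv_deriv_eq_mul {g : ℝ → ℝ} (hg : ContDiff ℝ ∞ g)
    (hind : ∀ a b : ℝ, (∀ v, a * deriv g v + b * g v = 0) → a = 0 ∧ b = 0)
    {Λ : ℝ → ℝ → ℝ → ℝ → ℝ → ℝ} (hΛ : Smooth5 Λ) (hm : IsMultiplierKG g Λ)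
    (hne : ¬ ∀ x u p q r : ℝ, deriv (fun s => Λ x u p q s) r = 0) :
    ∃ k : ℝ, ∀ v, deriv (deriv g) v = k * g v := by
  obtain ⟨F, hF⟩ : ∃ F, F = uncurry5 Λ := ⟨_, rfl⟩
  obtain ⟨A, hA⟩ : ∃ A, A = dirDeriv (0, 0, 0, 0, 1) F := ⟨_, rfl⟩
  obtain ⟨B, hB⟩ : ∃ B, B = dirDeriv (0, 0, 0, 1, 0) F := ⟨_, rfl⟩
  obtain ⟨C, hC⟩ : ∃ C, C = dirDeriv (0, 0, 1, 0, 0) F := ⟨_, rfl⟩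
  have sF : ContDiff ℝ ∞ F := hF ▸ hΛ
  have sA : ContDiff ℝ ∞ A := hA ▸ sF.dirDeriv _
  have sB : ContDiff ℝ ∞ B := hB ▸ sF.dirDeriv _
  have sC : ContDiff ℝ ∞ C := hC ▸ sF.dirDeriv _
  have det := determining_equations hg hΛ hm hF hA hB hC
  have Fu : dirDeriv (0, 1, 0, 0, 0) F = 0 := by
    funext ⟨x, v, p, q, r⟩
    exact (det x v p q r 0).1
  have Au : dirDeriv (0, 1, 0, 0, 0) A = 0 := hA ▸ dirDeriv_dirDeriv_eq_zero sF Fu _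
  have Bu : dirDeriv (0, 1, 0, 0, 0) B = 0 := hB ▸ dirDeriv_dirDeriv_eq_zero sF Fu _
  have Cu : dirDeriv (0, 1, 0, 0, 0) C = 0 := hC ▸ dirDeriv_dirDeriv_eq_zero sF Fu _
  have Ar : dirDeriv (0, 0, 0, 0, 1) A = 0 := by
    funext ⟨x, v, p, q, r⟩
    have h0 := (det x v p q r 0).2.1
    have h1 := (det x v p q r 1).2.1
    rw [dirDeriv_five] at h0 h1
    simp only [Pi.zero_apply]
    linarith
  have key : ∀ x p q r : ℝ, p * dirDeriv (0, 0, 0, 0, 1) B (x, 0, p, q, r) = 0 ∧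
      dirDeriv (0, 0, 0, 0, 1) C (x, 0, p, q, r) = 0 := by
    intro x p q r
    refine hind _ _ fun v => ?_
    have h0 := (det x v p q r 0).2.2
    have h1 := (det x v p q r 1).2.2
    rw [dirDeriv_five B, dirDeriv_five C] at h0 h1
    rw [← eq_of_dirDeriv_u_eq_zero (sB.dirDeriv _) (dirDeriv_dirDeriv_eq_zero sB Bu _) x v,
      ← eq_of_dirDeriv_u_eq_zero (sC.dirDeriv _) (dirDeriv_dirDeriv_eq_zero sC Cu _) x v]
    linarith
  have Cr : dirDeriv (0, 0, 0, 0, 1) C = 0 := by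
    funext ⟨x, v, p, q, r⟩
    rw [eq_of_dirDeriv_u_eq_zero (sC.dirDeriv _) (dirDeriv_dirDeriv_eq_zero sC Cu _)]
    exact (key x p q r).2
  have Ap : dirDeriv (0, 0, 1, 0, 0) A = 0 := by
    rw [hA, dirDeriv_comm sF, ← hC, Cr]
  have BrAq : dirDeriv (0, 0, 0, 0, 1) B = dirDeriv (0, 0, 0, 1, 0) A := by
    rw [hA, dirDeriv_comm sF, ← hB]
  have Aq : dirDeriv (0, 0, 0, 1, 0) A = 0 := by
    funext ⟨x, v, p, q, r⟩
    have hAqp := eq_of_dirDeriv_p_eq_zero (sA.dirDeriv (0, 0, 0, 1, 0))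
      (dirDeriv_dirDeriv_eq_zero sA Ap _) x 0
    rw [eq_of_dirDeriv_u_eq_zero (sA.dirDeriv _) (dirDeriv_dirDeriv_eq_zero sA Au _), hAqp,
      ← hAqp 1]
    have h1 := (key x 1 q r).1
    rw [BrAq] at h1
    simpa using h1
  have BAx : B = dirDeriv (1, 0, 0, 0, 0) A := by
    funext ⟨x, v, p, q, r⟩
    rw [(det x v p q r 0).2.1, dirDeriv_five, Au, Ap, Aq, Ar]
    simp
  have Bp : dirDeriv (0, 0, 1, 0, 0) B = 0 := BAx ▸ dirDeriv_dirDeriv_eq_zero sA Ap _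
  have Bq : dirDeriv (0, 0, 0, 1, 0) B = 0 := BAx ▸ dirDeriv_dirDeriv_eq_zero sA Aq _
  have Br : dirDeriv (0, 0, 0, 0, 1) B = 0 := BAx ▸ dirDeriv_dirDeriv_eq_zero sA Ar _
  have Cq : dirDeriv (0, 0, 0, 1, 0) C = 0 := by
    rw [hC, dirDeriv_comm sF, ← hB, Bp]
  obtain ⟨z, hz⟩ : ∃ z, A z ≠ 0 := by
    by_contra! hcon
    refine hne fun x u p q r => ?_
    have h1 := hasDerivAt_dirDeriv_line sF (x, u, p, q, 0) (0, 0, 0, 0, 1) r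
    rw [← hA, hcon] at h1
    simpa [hF, uncurry5] using h1.deriv
  obtain ⟨x, v₀, p₀, q₀, r₀⟩ := z
  have Aconst : ∀ v p q, A (x, v, p, q, 0) = A (x, 0, 0, 0, 0) := fun v p q => by
    rw [eq_of_dirDeriv_q_eq_zero sA Aq, eq_of_dirDeriv_p_eq_zero sA Ap,
      eq_of_dirDeriv_u_eq_zero sA Au]
  have Bconst : ∀ v p q, B (x, v, p, q, 0) = B (x, 0, 0, 0, 0) := fun v p q => by
    rw [eq_of_dirDeriv_q_eq_zero sB Bq, eq_of_dirDeriv_p_eq_zero sB Bp,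
      eq_of_dirDeriv_u_eq_zero sB Bu]
  have const : ∀ {K : ℝ × ℝ × ℝ × ℝ × ℝ → ℝ}, ContDiff ℝ ∞ K → dirDeriv (0, 1, 0, 0, 0) K = 0 →
      dirDeriv (0, 0, 0, 1, 0) K = 0 → ∀ v p q : ℝ, K (x, v, p, q, 0) = K (x, 0, p, 0, 0) :=
    fun sK Ku Kq v p q => by
      rw [eq_of_dirDeriv_q_eq_zero sK Kq, eq_of_dirDeriv_u_eq_zero sK Ku]
  rw [eq_of_dirDeriv_r_eq_zero sA Ar, Aconst] at hz
  have main : ∀ p v : ℝ, 3 * p * A (x, 0, 0, 0, 0) * deriv (deriv g) v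
      + B (x, 0, 0, 0, 0) * deriv g v
      + dirDeriv (0, 0, 1, 0, 0) C (x, 0, p, 0, 0) * g v = 0 := by
    intro p v
    have h0 := (det x v p 0 0 0).2.2
    have h1 := (det x v p 1 0 0).2.2
    have hFq : F (x, v, p, 1, 0) = F (x, v, p, 0, 0) + B (x, v, p, 0, 0) := by
      have h2 := apply_add_smul_of_dirDeriv_dirDeriv_eq_zero sF (hB ▸ Bq) (x, v, p, 0, 0)
      simpa [← hB] using h2
    rw [dirDeriv_five B, dirDeriv_five C, hFq] at h1
    rw [dirDeriv_five B, dirDeriv_five C] at h0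
    have Cx := const (sC.dirDeriv (1, 0, 0, 0, 0)) (dirDeriv_dirDeriv_eq_zero sC Cu _)
      (dirDeriv_dirDeriv_eq_zero sC Cq _) v p
    have Cp := const (sC.dirDeriv (0, 0, 1, 0, 0)) (dirDeriv_dirDeriv_eq_zero sC Cu _)
      (dirDeriv_dirDeriv_eq_zero sC Cq _) v p
    have Bx := const (sB.dirDeriv (1, 0, 0, 0, 0)) (dirDeriv_dirDeriv_eq_zero sB Bu _)
      (dirDeriv_dirDeriv_eq_zero sB Bq _) v p
    have Cc := const sC Cu Cq v p
    simp only [Aconst, Bconst, Cx, Cp, Bx, Cc, Bu, Bp, Bq, Br, Cu, Cq, Cr, Pi.zero_apply] at h0 h1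
    linarith
  have hB0 : B (x, 0, 0, 0, 0) = 0 := (hind _ _ fun v => by simpa using main 0 v).1
  refine ⟨-dirDeriv (0, 0, 1, 0, 0) C (x, 0, 1, 0, 0) / (3 * A (x, 0, 0, 0, 0)), fun v => ?_⟩
  have h := main 1 v
  rw [hB0] at h
  field_simp
  linarith

theorem eq_mul_exp_of_hasDerivAt {h : ℝ → ℝ} {c : ℝ} (hh : ∀ v, HasDerivAt h (c * h v) v) (v : ℝ) :
    h v = h 0 * Real.exp (c * v) := by
  have h1 : ∀ v, HasDerivAt (fun v => h v * Real.exp (-c * v)) 0 v := fun v => by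
    refine HasDerivAt.congr_deriv ((hh v).mul (((hasDerivAt_id v).const_mul (-c)).exp)) ?_
    simp only [id]
    ring
  have h2 := is_const_of_deriv_eq_zero (fun v => (h1 v).differentiableAt)
    (fun v => (h1 v).deriv) v 0
  simp only [mul_zero, Real.exp_zero, mul_one] at h2
  rw [← h2, mul_assoc, ← Real.exp_add]
  simp

/-- Solutions of `g'' = σ² g`. -/
theorem exists_eq_exp_add_exp {g g' : ℝ → ℝ} {σ : ℝ} (hσ : σ ≠ 0)
    (h0 : ∀ v, HasDerivAt g (g' v) v) (h1 : ∀ v, HasDerivAt g' (σ ^ 2 * g v) v) :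
    ∃ α γ : ℝ, ∀ v, g v = α * Real.exp (σ * v) + γ * Real.exp (-σ * v) := by
  have ha := eq_mul_exp_of_hasDerivAt (h := fun v => g' v + σ * g v) (c := σ) fun v => by
    refine HasDerivAt.congr_deriv ((h1 v).add ((h0 v).const_mul σ)) ?_
    ring
  have hb := eq_mul_exp_of_hasDerivAt (h := fun v => g' v - σ * g v) (c := -σ) fun v => by
    refine HasDerivAt.congr_deriv ((h1 v).sub ((h0 v).const_mul σ)) ?_
    ring
  refine ⟨(g' 0 + σ * g 0) / (2 * σ), -(g' 0 - σ * g 0) / (2 * σ), fun v => ?_⟩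
  have ha := ha v
  have hb := hb v
  rw [neg_mul] at hb ⊢
  field_simp
  linarith

/-- Solutions of `g'' = -σ² g`. -/
theorem exists_eq_mul_sin {g g' : ℝ → ℝ} {σ : ℝ} (hσ : σ ≠ 0)
    (h0 : ∀ v, HasDerivAt g (g' v) v) (h1 : ∀ v, HasDerivAt g' (-σ ^ 2 * g v) v) :
    ∃ α β : ℝ, ∀ v, g v = α * Real.sin (σ * v + β) := by
  have hs : ∀ v, HasDerivAt (fun v => Real.sin (σ * v)) (Real.cos (σ * v) * σ) v := fun v => by
    simpa using ((hasDerivAt_id v).const_mul σ).sin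
  have hc : ∀ v, HasDerivAt (fun v => Real.cos (σ * v)) (-Real.sin (σ * v) * σ) v := fun v => by
    simpa using ((hasDerivAt_id v).const_mul σ).cos
  have ha : ∀ v, HasDerivAt (fun v => σ * g v * Real.cos (σ * v) - g' v * Real.sin (σ * v)) 0 v :=
    fun v => by
      refine HasDerivAt.congr_deriv ((((h0 v).const_mul σ).mul (hc v)).sub ((h1 v).mul (hs v))) ?_
      ring
  have hb : ∀ v, HasDerivAt (fun v => σ * g v * Real.sin (σ * v) + g' v * Real.cos (σ * v)) 0 v :=
    fun v => by
      refine HasDerivAt.congr_deriv ((((h0 v).const_mul σ).mul (hs v)).add ((h1 v).mul (hc v))) ?_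
      ring
  set z : ℂ := ⟨g' 0 / σ, g 0⟩ with hz
  refine ⟨‖z‖, z.arg, fun v => ?_⟩
  have ha := is_const_of_deriv_eq_zero (fun v => (ha v).differentiableAt)
    (fun v => (ha v).deriv) v 0
  have hb := is_const_of_deriv_eq_zero (fun v => (hb v).differentiableAt)
    (fun v => (hb v).deriv) v 0
  have hre : ‖z‖ * Real.cos z.arg = g' 0 / σ := Complex.norm_mul_cos_arg z
  have him : ‖z‖ * Real.sin z.arg = g 0 := Complex.norm_mul_sin_arg z
  simp only [mul_zero, Real.cos_zero, Real.sin_zero, mul_one, sub_zero, zero_add] at ha hb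
  have hgoal : ‖z‖ * Real.sin (σ * v + z.arg) =
      Real.sin (σ * v) * (g' 0 / σ) + Real.cos (σ * v) * g 0 := by
    rw [Real.sin_add, ← hre, ← him]
    ring
  rw [hgoal]
  field_simp
  linear_combination (-σ * g v) * (Real.sin_sq_add_cos_sq (σ * v)) +
    Real.cos (σ * v) * ha + Real.sin (σ * v) * hb

/-- The nonlinearities satisfying `g'' = k g` for some `k`. -/
theorem classification_of_deriv_deriv_eq_mul {g : ℝ → ℝ} (hg : ContDiff ℝ ∞ g)
    (hg'' : ¬ ∀ u : ℝ, deriv (deriv g) u = 0) {k : ℝ} (hk : ∀ v, deriv (deriv g) v = k * g v) :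
    (∃ α σ : ℝ, α * σ ≠ 0 ∧ ∀ u : ℝ, g u = α * Real.exp (σ * u)) ∨
      (∃ α σ β : ℝ, α * σ ≠ 0 ∧ ∀ u : ℝ, g u = α * Real.sin (σ * u + β)) ∨
      (∃ α γ σ : ℝ, σ ≠ 0 ∧ α * γ ≠ 0 ∧
        ∀ u : ℝ, g u = α * Real.exp (σ * u) + γ * Real.exp (-σ * u)) := by
  have dg : ContDiff ℝ ∞ (deriv g) := (contDiff_infty_iff_deriv.1 hg).2
  have h0 : ∀ v, HasDerivAt g (deriv g v) v := fun v =>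
    (hg.differentiable (by simp) v).hasDerivAt
  have h1 : ∀ v, HasDerivAt (deriv g) (k * g v) v := fun v =>
    hk v ▸ (dg.differentiable (by simp) v).hasDerivAt
  have hg0 : ¬ ∀ v, g v = 0 := fun h => hg'' fun u => by rw [hk, h, mul_zero]
  rcases lt_trichotomy k 0 with hneg | rfl | hpos
  · have hσ : √(-k) ≠ 0 := (Real.sqrt_pos.2 (by linarith)).ne'
    have hσk : -√(-k) ^ 2 = k := by rw [Real.sq_sqrt (by linarith), neg_neg]
    obtain ⟨α, β, h⟩ := exists_eq_mul_sin hσ h0 (by rwa [hσk])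
    refine Or.inr (Or.inl ⟨α, √(-k), β, mul_ne_zero ?_ hσ, h⟩)
    rintro rfl
    exact hg0 fun v => by rw [h, zero_mul]
  · exact absurd (fun u => by rw [hk, zero_mul]) hg''
  · have hσ : √k ≠ 0 := (Real.sqrt_pos.2 hpos).ne'
    obtain ⟨α, γ, h⟩ := exists_eq_exp_add_exp hσ h0 (by rwa [Real.sq_sqrt hpos.le])
    by_cases hα : α = 0
    · refine Or.inl ⟨γ, -√k, mul_ne_zero ?_ (neg_ne_zero.2 hσ), fun u => by rw [h, hα]; ring⟩
      rintro rfl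
      exact hg0 fun v => by rw [h, hα]; ring
    by_cases hγ : γ = 0
    · exact Or.inl ⟨α, √k, mul_ne_zero hα hσ, fun u => by rw [h, hγ]; ring⟩
    exact Or.inr (Or.inr ⟨α, γ, √k, hσ, mul_ne_zero hα hγ, h⟩)

theorem classification_of_dependent {g : ℝ → ℝ} (hg : ContDiff ℝ ∞ g)
    (hg'' : ¬ ∀ u : ℝ, deriv (deriv g) u = 0) {a b : ℝ} (hab : ¬ (a = 0 ∧ b = 0))
    (h : ∀ v, a * deriv g v + b * g v = 0) :
    ∃ α σ : ℝ, α * σ ≠ 0 ∧ ∀ u : ℝ, g u = α * Real.exp (σ * u) := by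
  have ha : a ≠ 0 := by
    rintro rfl
    have hb : b ≠ 0 := fun hb => hab ⟨rfl, hb⟩
    have hg0 : g = fun _ => 0 := funext fun v => by simpa [hb] using h v
    exact hg'' fun u => by simp [hg0]
  have hexp := eq_mul_exp_of_hasDerivAt (h := g) (c := -b / a) fun v => by
    have h1 : deriv g v = -b / a * g v := by
      field_simp
      linarith [h v]
    exact h1 ▸ (hg.differentiable (by simp) v).hasDerivAt
  refine ⟨g 0, -b / a, mul_ne_zero (fun h0 => ?_) (fun h0 => ?_), hexp⟩
  · have hg0 : g = fun _ => 0 := funext fun v => by rw [hexp, h0, zero_mul]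
    exact hg'' fun u => by simp [hg0]
  · have hg0 : g = fun _ => g 0 := funext fun v => by rw [hexp, h0]; simp
    exact hg'' fun u => by rw [hg0]; simp

theorem deriv_deriv_eq_of_hasDerivAt {g g' g'' : ℝ → ℝ} (h0 : ∀ v, HasDerivAt g (g' v) v)
    (h1 : ∀ v, HasDerivAt g' (g'' v) v) : deriv (deriv g) = g'' := by
  rw [funext fun v => (h0 v).deriv]
  exact funext fun v => (h1 v).deriv

theorem exists_deriv_deriv_eq_mul_of_form {g : ℝ → ℝ}
    (h : (∃ α σ : ℝ, α * σ ≠ 0 ∧ ∀ u : ℝ, g u = α * Real.exp (σ * u)) ∨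
      (∃ α σ β : ℝ, α * σ ≠ 0 ∧ ∀ u : ℝ, g u = α * Real.sin (σ * u + β)) ∨
      (∃ α γ σ : ℝ, σ ≠ 0 ∧ α * γ ≠ 0 ∧
        ∀ u : ℝ, g u = α * Real.exp (σ * u) + γ * Real.exp (-σ * u))) :
    ∃ k : ℝ, ∀ v, deriv (deriv g) v = k * g v := by
  have he : ∀ α σ v : ℝ, HasDerivAt (fun u => α * Real.exp (σ * u))
      (α * σ * Real.exp (σ * v)) v := fun α σ v => by
    refine HasDerivAt.congr_deriv ((((hasDerivAt_id v).const_mul σ).exp).const_mul α) ?_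
    simp only [id]
    ring
  rcases h with ⟨α, σ, -, h⟩ | ⟨α, σ, β, -, h⟩ | ⟨α, γ, σ, -, -, h⟩
  · obtain rfl : g = _ := funext h
    refine ⟨σ ^ 2, fun v => ?_⟩
    rw [deriv_deriv_eq_of_hasDerivAt (he α σ) (he _ σ)]
    ring
  · obtain rfl : g = _ := funext h
    have hs : ∀ v, HasDerivAt (fun u => α * Real.sin (σ * u + β))
        (α * σ * Real.cos (σ * v + β)) v := fun v => by
      refine HasDerivAt.congr_deriv
        (((((hasDerivAt_id v).const_mul σ).add_const β).sin).const_mul α) ?_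
      simp only [id]
      ring
    have hc : ∀ v, HasDerivAt (fun u => α * σ * Real.cos (σ * u + β))
        (-α * σ ^ 2 * Real.sin (σ * v + β)) v := fun v => by
      refine HasDerivAt.congr_deriv
        (((((hasDerivAt_id v).const_mul σ).add_const β).cos).const_mul (α * σ)) ?_
      simp only [id]
      ring
    refine ⟨-σ ^ 2, fun v => ?_⟩
    rw [deriv_deriv_eq_of_hasDerivAt hs hc]
    ring
  · obtain rfl : g = _ := funext h
    refine ⟨σ ^ 2, fun v => ?_⟩
    have h1 : deriv (deriv fun u => α * Real.exp (σ * u) + γ * Real.exp (-σ * u)) = _ :=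
      deriv_deriv_eq_of_hasDerivAt (fun v => (he α σ v).add (he γ (-σ) v))
        (fun v => (he _ σ v).add (he _ (-σ) v))
    rw [h1]
    ring

/-- The index of `∂_t^i ∂_x^j u` in the jet of order `4`. -/
def jetIdx (i j : Fin 5) (h : (i : ℕ) + (j : ℕ) ≤ 4 := by decide) : JetIdx 4 := ⟨(i, j), h⟩

theorem isMultiplierKG_of_deriv_deriv_eq {g : ℝ → ℝ} (hg : ContDiff ℝ ∞ g) {k : ℝ}
    (hk : ∀ v, deriv (deriv g) v = k * g v) :
    IsMultiplierKG g (fun _ _ p _ r => r - k / 2 * p ^ 3) := by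
  have dg : ContDiff ℝ ∞ (deriv g) := (contDiff_infty_iff_deriv.1 hg).2
  have sJ : ∀ i : JetIdx 4, ContDiff ℝ ∞ fun z : ℝ × ℝ × (JetIdx 4 → ℝ) => z.2.2 i :=
    fun i => (contDiff_apply ℝ ℝ i).comp (contDiff_snd.comp contDiff_snd)
  refine ⟨fun z => -(z.2.2 (jetIdx 0 2)) ^ 2 / 2 - k / 8 * z.2.2 (jetIdx 0 1) ^ 4,
    fun z => z.2.2 (jetIdx 1 1) * z.2.2 (jetIdx 0 2) - g (z.2.2 (jetIdx 0 0)) * z.2.2 (jetIdx 0 2)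
      + deriv g (z.2.2 (jetIdx 0 0)) * z.2.2 (jetIdx 0 1) ^ 2 / 2, ?_, ?_, ?_⟩
  · exact (((sJ _).pow 2).neg.div_const 2).sub (contDiff_const.mul ((sJ _).pow 4))
  · exact (((sJ _).mul (sJ _)).sub ((hg.comp (sJ _)).mul (sJ _))).add
      (((dg.comp (sJ _)).mul ((sJ _).pow 2)).div_const 2)
  intro u hu t x
  obtain ⟨W, hWu⟩ : ∃ W : ℝ × ℝ → ℝ, W = fun y => u y.1 y.2 := ⟨_, rfl⟩
  have hW : ContDiff ℝ ∞ W := hWu ▸ hu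
  obtain rfl : u = fun t x => W (t, x) := by rw [hWu]
  have dt : ∀ i j,
      HasDerivAt (fun s => mixedDeriv i j W (s, x)) (mixedDeriv (i + 1) j W (t, x)) t :=
    fun i j => dirDeriv_fst_mixedDeriv (W := W) i j ▸
      hasDerivAt_fst_dirDeriv (hW.mixedDeriv i j) t x
  have dx : ∀ i j,
      HasDerivAt (fun y => mixedDeriv i j W (t, y)) (mixedDeriv i (j + 1) W (t, x)) x :=
    fun i j => dirDeriv_snd_mixedDeriv hW i j ▸ hasDerivAt_snd_dirDeriv (hW.mixedDeriv i j) t x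
  have hjet : ∀ (i j : Fin 5) (h : (i : ℕ) + (j : ℕ) ≤ 4) (s y : ℝ),
      jet 4 (fun t x => W (t, x)) s y (jetIdx i j h) = mixedDeriv i j W (s, y) :=
    fun i j h s y => by simp only [jet, jetIdx, pd_eq_mixedDeriv hW]
  have e0 : mixedDeriv 0 0 W = W := rfl
  simp only [pd_eq_mixedDeriv hW, hjet]
  have dx0 := dx 0 0
  have hg1 := ((hg.differentiable (by simp) (W (t, x))).hasDerivAt).comp x dx0
  have hg2 := ((dg.differentiable (by simp) (W (t, x))).hasDerivAt).comp x dx0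
  have hT := (((dt 0 2).pow 2).neg.div_const 2).sub (((dt 0 1).pow 4).const_mul (k / 8))
  have hX := (((dx 1 1).mul (dx 0 2)).sub (hg1.mul (dx 0 2))).add
    ((hg2.mul ((dx 0 1).pow 2)).div_const 2)
  refine Eq.trans ?_ (congrArg₂ (· + ·) hT.deriv.symm hX.deriv.symm)
  simp only [hk, e0, Function.comp_apply, Pi.pow_apply]
  push_cast
  ring

/-- The Klein–Gordon equation `u_tx = g(u)` with `g''` not identically zero
admits a conservation-law multiplier `Λ(x,u,u_x,u_xx,u_xxx)` with
`∂Λ/∂u_xxx` not identically zero iff `g` is (up to scalings and a shift) a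
Liouville, sine-Gordon or sinh-Gordon nonlinearity. -/
theorem kleinGordon_second_order_classification
    (g : ℝ → ℝ) (hg : ContDiff ℝ (⊤ : ℕ∞) g)
    (hg'' : ¬ ∀ u : ℝ, deriv (deriv g) u = 0) :
    (∃ Λ : ℝ → ℝ → ℝ → ℝ → ℝ → ℝ, Smooth5 Λ ∧ IsMultiplierKG g Λ ∧
        ¬ ∀ x u p q r : ℝ, deriv (fun s => Λ x u p q s) r = 0) ↔
      ((∃ α σ : ℝ, α * σ ≠ 0 ∧ ∀ u : ℝ, g u = α * Real.exp (σ * u)) ∨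
       (∃ α σ β : ℝ, α * σ ≠ 0 ∧ ∀ u : ℝ, g u = α * Real.sin (σ * u + β)) ∨
       (∃ α γ σ : ℝ, σ ≠ 0 ∧ α * γ ≠ 0 ∧
          ∀ u : ℝ, g u = α * Real.exp (σ * u) + γ * Real.exp (-σ * u))) := by
  constructor
  · rintro ⟨Λ, hΛ, hm, hne⟩
    by_cases hind : ∀ a b : ℝ, (∀ v, a * deriv g v + b * g v = 0) → a = 0 ∧ b = 0
    · obtain ⟨k, hk⟩ := exists_deriv_deriv_eq_mul hg hind hΛ hm hne
      exact classification_of_deriv_deriv_eq_mul hg hg'' hk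
    · push Not at hind
      obtain ⟨a, b, h, hab⟩ := hind
      exact Or.inl (classification_of_dependent hg hg'' (fun h0 => hab h0.1 h0.2) h)
  · intro h
    obtain ⟨k, hk⟩ := exists_deriv_deriv_eq_mul_of_form h
    refine ⟨_, ?_, isMultiplierKG_of_deriv_deriv_eq hg hk, fun h0 => ?_⟩
    · unfold Smooth5
      fun_prop
    · have h1 := h0 0 0 0 0 0
      simp at h1
end
end

section
/- For the sine-Gordon equation u_tx = sin u (that is, g(u) = sin u), a smooth function Λ(x,u,u_x,u_xx,u_xxx) is a conservation-law multiplier if and only if Λ = a·(u_xxx + u_x³/2) + b·u_x for some real constants a, b. For the sinh-Gordon equations u_tx = e^u + e^{−u} and u_tx = e^u − e^{−u}, a smooth Λ(x,u,u_x,u_xx,u_xxx) is a conservation-law multiplier if and only if Λ = a·(u_xxx − u_x³/2) + b·u_x for some real constants a, b. -/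
noncomputable section

/-- The partial derivative of a function on `ℝ⁵` along the `i`-th coordinate. -/
def coordDeriv (i : Fin 5) (f : (Fin 5 → ℝ) → ℝ) : (Fin 5 → ℝ) → ℝ :=
  fun z => fderiv ℝ f z (Pi.single i 1)

theorem contDiff_coordDeriv {f : (Fin 5 → ℝ) → ℝ} (hf : ContDiff ℝ (⊤ : ℕ∞) f) (i : Fin 5) :
    ContDiff ℝ (⊤ : ℕ∞) (coordDeriv i f) :=
  (hf.fderiv_right (m := (⊤ : ℕ∞)) (by simp)).clm_apply contDiff_const

theorem fderiv_eq_sum_coordDeriv (f : (Fin 5 → ℝ) → ℝ) (z w : Fin 5 → ℝ) :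
    fderiv ℝ f z w = ∑ i, w i * coordDeriv i f z := by
  conv_lhs => rw [pi_eq_sum_univ' w]
  simp [coordDeriv, map_sum]

theorem hasDerivAt_comp_curve {f : (Fin 5 → ℝ) → ℝ} (hf : ContDiff ℝ (⊤ : ℕ∞) f)
    {c : ℝ → Fin 5 → ℝ} {c' : Fin 5 → ℝ} {x : ℝ} (hc : ∀ i, HasDerivAt (fun y => c y i) (c' i) x) :
    HasDerivAt (fun y => f (c y)) (∑ i, c' i * coordDeriv i f (c x)) x := by
  rw [← fderiv_eq_sum_coordDeriv]
  exact ((hf.differentiable (by simp)) (c x)).hasFDerivAt.comp_hasDerivAt x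
    (hasDerivAt_pi.2 hc)

theorem coordDeriv_comm {f : (Fin 5 → ℝ) → ℝ} (hf : ContDiff ℝ (⊤ : ℕ∞) f) (i j : Fin 5)
    (z : Fin 5 → ℝ) : coordDeriv i (coordDeriv j f) z = coordDeriv j (coordDeriv i f) z := by
  have hsymm : IsSymmSndFDerivAt ℝ f z :=
    hf.contDiffAt.isSymmSndFDerivAt (by
      simp only [minSmoothness_of_isRCLikeNormedField]; exact WithTop.coe_le_coe.2 le_top)
  have hd : DifferentiableAt ℝ (fderiv ℝ f) z :=
    (hf.fderiv_right (m := (⊤ : ℕ∞)) (by simp)).differentiable (by simp) z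
  have key : ∀ a b : Fin 5, coordDeriv a (coordDeriv b f) z =
      fderiv ℝ (fderiv ℝ f) z (Pi.single a 1) (Pi.single b 1) := by
    intro a b
    unfold coordDeriv
    rw [fderiv_clm_apply hd (differentiableAt_const _)]
    simp
  rw [key, key]
  exact hsymm _ _

theorem apply_update_of_coordDeriv_eq_zero {f : (Fin 5 → ℝ) → ℝ} (hf : ContDiff ℝ (⊤ : ℕ∞) f)
    {i : Fin 5} (h : ∀ z, coordDeriv i f z = 0) (z : Fin 5 → ℝ) (a : ℝ) :
    f (Function.update z i a) = f z := by
  have hd : ∀ y, HasDerivAt (fun y => f (Function.update z i y)) 0 y := by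
    intro y
    have := hasDerivAt_comp_curve hf (c := fun y => Function.update z i y)
      (c' := Pi.single i 1) (x := y) (by
        intro j
        by_cases hj : j = i
        · subst hj; simpa using hasDerivAt_id' y
        · simpa [Function.update_of_ne hj, Pi.single_eq_of_ne hj] using hasDerivAt_const y (z j))
    simpa [Pi.single_apply, h] using this
  have := is_const_of_deriv_eq_zero (fun y => (hd y).differentiableAt) (fun y => (hd y).deriv)
    a (z i)
  simpa using this

theorem eq_of_coordDeriv_eq_zero {f : (Fin 5 → ℝ) → ℝ} (hf : ContDiff ℝ (⊤ : ℕ∞) f)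
    (h : ∀ i z, coordDeriv i f z = 0) (z w : Fin 5 → ℝ) : f z = f w := by
  refine is_const_of_fderiv_eq_zero (𝕜 := ℝ) (hf.differentiable (by simp)) (fun y => ?_) z w
  ext w
  simp [fderiv_eq_sum_coordDeriv, h]

/-- The total `x`-derivative of a function of the jet `z = (x, u, u_x, u_xx, u_xxx)`,
where `s` is the value of `u_xxxx`. -/
def totalDeriv (f : (Fin 5 → ℝ) → ℝ) (z : Fin 5 → ℝ) (s : ℝ) : ℝ :=
  coordDeriv 0 f z + z 2 * coordDeriv 1 f z + z 3 * coordDeriv 2 f z + z 4 * coordDeriv 3 f z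
    + s * coordDeriv 4 f z

theorem coordDeriv_zero_fun {f : (Fin 5 → ℝ) → ℝ} (h : ∀ z, f z = 0) (i : Fin 5)
    (z : Fin 5 → ℝ) : coordDeriv i f z = 0 := by
  rw [show f = fun _ => 0 from funext h]
  simp [coordDeriv]

theorem coordDeriv_coord (i j : Fin 5) (z : Fin 5 → ℝ) :
    coordDeriv i (fun z => z j) z = if i = j then 1 else 0 := by
  unfold coordDeriv
  rw [(hasFDerivAt_apply (𝕜 := ℝ) j z).fderiv]
  simp [Pi.single_apply, eq_comm]

theorem coordDeriv_add {f g : (Fin 5 → ℝ) → ℝ} (hf : ContDiff ℝ (⊤ : ℕ∞) f)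
    (hg : ContDiff ℝ (⊤ : ℕ∞) g) (i : Fin 5) (z : Fin 5 → ℝ) :
    coordDeriv i (fun z => f z + g z) z = coordDeriv i f z + coordDeriv i g z := by
  unfold coordDeriv
  rw [fderiv_fun_add (hf.differentiable (by simp) z) (hg.differentiable (by simp) z)]
  simp

theorem coordDeriv_mul {f g : (Fin 5 → ℝ) → ℝ} (hf : ContDiff ℝ (⊤ : ℕ∞) f)
    (hg : ContDiff ℝ (⊤ : ℕ∞) g) (i : Fin 5) (z : Fin 5 → ℝ) :
    coordDeriv i (fun z => f z * g z) z = f z * coordDeriv i g z + g z * coordDeriv i f z := by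
  unfold coordDeriv
  rw [fderiv_fun_mul (hf.differentiable (by simp) z) (hg.differentiable (by simp) z)]
  simp

theorem coordDeriv_const_mul_sq (c : ℝ) (i j : Fin 5) (z : Fin 5 → ℝ) :
    coordDeriv i (fun z => c * z j ^ 2) z = if i = j then 2 * c * z j else 0 := by
  unfold coordDeriv
  rw [(((hasFDerivAt_apply (𝕜 := ℝ) j z).pow 2).const_mul c).fderiv]
  by_cases h : i = j
  · subst h; simp; ring
  · simp [Ne.symm h, h]

/-- Solution of the determining equations. -/
theorem eq_of_determining_equations {L : (Fin 5 → ℝ) → ℝ} (hL : ContDiff ℝ (⊤ : ℕ∞) L) {σ : ℝ}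
    (hσ : σ ≠ 0) (h1 : ∀ z, coordDeriv 1 L z = 0)
    (h3 : ∀ z s, coordDeriv 3 L z = totalDeriv (coordDeriv 4 L) z s)
    (hP : ∀ z s, totalDeriv (coordDeriv 2 L) z s + σ * (3 * z 2 * z 3 * coordDeriv 4 L z
      + 2 * z 2 ^ 2 * totalDeriv (coordDeriv 4 L) z s) = 0)
    (hQ : ∀ z s, L z = z 2 * coordDeriv 2 L z + σ * z 2 ^ 3 * coordDeriv 4 L z
      + z 4 * coordDeriv 4 L z + 2 * z 3 * coordDeriv 3 L z
      + z 2 * totalDeriv (coordDeriv 3 L) z s) :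
    ∃ a b : ℝ, ∀ z, L z = a * (z 4 - σ * z 2 ^ 3 / 2) + b * z 2 := by
  have hS := contDiff_coordDeriv hL
  have hSS := fun i j => contDiff_coordDeriv (hS j) i
  have hcomm := coordDeriv_comm hL
  have hcomm' := fun i j k => coordDeriv_comm (hS k) i j
  obtain ⟨f, hf⟩ : ∃ f, f = coordDeriv 4 L := ⟨_, rfl⟩
  have hfS : ContDiff ℝ (⊤ : ℕ∞) f := hf ▸ hS 4
  have hfcomm := coordDeriv_comm hfS
  have hfc : ∀ i z, coordDeriv 4 (coordDeriv i L) z = coordDeriv i f z := by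
    intro i z; rw [hcomm, hf]
  have h1i : ∀ i z, coordDeriv 1 (coordDeriv i L) z = 0 := by
    intro i z
    rw [hcomm, coordDeriv_zero_fun h1]
  rw [← hf] at h3 hP hQ
  have f1 : ∀ z, coordDeriv 1 f z = 0 := by intro z; rw [hf]; exact h1i 4 z
  have f4 : ∀ z, coordDeriv 4 f z = 0 := by
    intro z
    have e1 := h3 z 0
    have e2 := h3 z 1
    unfold totalDeriv at e1 e2
    linarith
  have f2 : ∀ z, coordDeriv 2 f z = 0 := by
    intro z
    have e1 := hP z 0
    have e2 := hP z 1
    unfold totalDeriv at e1 e2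
    rw [f4, hfc] at e1 e2
    linarith
  have h3' : ∀ z, coordDeriv 3 L z = coordDeriv 0 f z + z 4 * coordDeriv 3 f z := by
    intro z
    have e := h3 z 0
    unfold totalDeriv at e
    rw [f1, f2] at e
    linarith
  have fi2 : ∀ i z, coordDeriv 2 (coordDeriv i f) z = 0 := by
    intro i z; rw [hfcomm, coordDeriv_zero_fun f2]
  have fi4 : ∀ i z, coordDeriv 4 (coordDeriv i f) z = 0 := by
    intro i z; rw [hfcomm, coordDeriv_zero_fun f4]
  have h23 : ∀ z, coordDeriv 2 (coordDeriv 3 L) z = 0 := by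
    intro z
    rw [show coordDeriv 3 L = fun z => coordDeriv 0 f z + z 4 * coordDeriv 3 f z from funext h3']
    rw [coordDeriv_add (contDiff_coordDeriv hfS 0)
      ((contDiff_apply ℝ ℝ 4).mul (contDiff_coordDeriv hfS 3)),
      coordDeriv_mul (contDiff_apply ℝ ℝ 4) (contDiff_coordDeriv hfS 3), fi2, fi2,
      coordDeriv_coord]
    simp
  have hP' : ∀ z, coordDeriv 0 (coordDeriv 2 L) z + z 3 * coordDeriv 2 (coordDeriv 2 L) z
      + σ * (3 * z 2 * z 3 * f z
        + 2 * z 2 ^ 2 * (coordDeriv 0 f z + z 4 * coordDeriv 3 f z)) = 0 := by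
    intro z
    have e := hP z 0
    rw [← h3, h3'] at e
    unfold totalDeriv at e
    rw [h1i, hcomm 3 2, h23] at e
    linarith
  have hi2L4 : ∀ i z, coordDeriv 4 (coordDeriv i (coordDeriv 2 L)) z = 0 := by
    intro i z
    rw [hcomm', coordDeriv_zero_fun (fun z => (hfc 2 z).trans (f2 z))]
  have f3 : ∀ z, coordDeriv 3 f z = 0 := by
    intro z
    have e1 := hP' (Function.update (Function.update z 2 1) 4 0)
    have e2 := hP' (Function.update (Function.update z 2 1) 4 1)
    simp only [apply_update_of_coordDeriv_eq_zero (hSS _ _) (hi2L4 _),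
      apply_update_of_coordDeriv_eq_zero hfS f4,
      apply_update_of_coordDeriv_eq_zero (contDiff_coordDeriv hfS _) (fi4 _),
      apply_update_of_coordDeriv_eq_zero hfS f2,
      apply_update_of_coordDeriv_eq_zero (contDiff_coordDeriv hfS _) (fi2 _)] at e1 e2
    simp at e1 e2
    have : σ * coordDeriv 3 f z = 0 := by linarith
    simpa [hσ] using this
  have h3'' : ∀ z, coordDeriv 3 L z = coordDeriv 0 f z := by
    intro z; rw [h3', f3]; ring
  have fi3 : ∀ i z, coordDeriv 3 (coordDeriv i f) z = 0 := by
    intro i z; rw [hfcomm, coordDeriv_zero_fun f3]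
  have hi2L3 : ∀ i z, coordDeriv 3 (coordDeriv i (coordDeriv 2 L)) z = 0 := by
    intro i z
    rw [hcomm', coordDeriv_zero_fun (fun z => (hcomm 3 2 z).trans (h23 z))]
  have hAB : ∀ z y, coordDeriv 0 (coordDeriv 2 L) z + y * coordDeriv 2 (coordDeriv 2 L) z
      + σ * (3 * z 2 * y * f z + 2 * z 2 ^ 2 * coordDeriv 0 f z) = 0 := by
    intro z y
    have e := hP' (Function.update z 3 y)
    simp only [apply_update_of_coordDeriv_eq_zero (hSS _ _) (hi2L3 _),
      apply_update_of_coordDeriv_eq_zero hfS f3,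
      apply_update_of_coordDeriv_eq_zero (contDiff_coordDeriv hfS _) (fi3 _), f3] at e
    simpa using e
  have hA : ∀ z, coordDeriv 0 (coordDeriv 2 L) z = (-(2 * σ) * z 2 ^ 2) * coordDeriv 0 f z := by
    intro z; linarith [hAB z 0]
  have hB : ∀ z, coordDeriv 2 (coordDeriv 2 L) z = (-(3 * σ) * z 2) * f z := by
    intro z; linarith [hAB z 0, hAB z 1]
  have hc1 : ContDiff ℝ (⊤ : ℕ∞) (fun z : Fin 5 → ℝ => -(2 * σ) * z 2 ^ 2) :=
    contDiff_const.mul ((contDiff_apply ℝ ℝ 2).pow 2)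
  have hc2 : ContDiff ℝ (⊤ : ℕ∞) (fun z : Fin 5 → ℝ => -(3 * σ) * z 2) :=
    contDiff_const.mul (contDiff_apply ℝ ℝ 2)
  have f0p : ∀ z, σ * z 2 * coordDeriv 0 f z = 0 := by
    intro z
    have e := hcomm' 2 0 2 z
    rw [show coordDeriv 0 (coordDeriv 2 L)
        = fun z => (-(2 * σ) * z 2 ^ 2) * coordDeriv 0 f z from funext hA,
      show coordDeriv 2 (coordDeriv 2 L) = fun z => (-(3 * σ) * z 2) * f z from funext hB,
      coordDeriv_mul hc1 (contDiff_coordDeriv hfS 0), coordDeriv_mul hc2 hfS,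
      coordDeriv_const_mul_sq, fi2, coordDeriv_mul contDiff_const (contDiff_apply ℝ ℝ 2),
      coordDeriv_coord] at e
    have : coordDeriv 0 (fun _ => -(3 * σ)) z = 0 := by simp [coordDeriv]
    rw [this] at e
    simp at e
    linarith
  have f0 : ∀ z, coordDeriv 0 f z = 0 := by
    intro z
    have e := f0p (Function.update z 2 1)
    rw [apply_update_of_coordDeriv_eq_zero (contDiff_coordDeriv hfS _) (fi2 _)] at e
    simpa [hσ] using e
  have fconst : ∀ z, f z = f 0 := fun z => by
    refine eq_of_coordDeriv_eq_zero hfS (fun i => ?_) z 0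
    fin_cases i
    exacts [f0, f1, f2, f3, f4]
  have hd : ContDiff ℝ (⊤ : ℕ∞) (fun z : Fin 5 → ℝ => 3 * σ * f 0 / 2 * z 2 ^ 2) :=
    contDiff_const.mul ((contDiff_apply ℝ ℝ 2).pow 2)
  have hb : ∀ z, coordDeriv 2 L z + 3 * σ * f 0 / 2 * z 2 ^ 2 = coordDeriv 2 L 0 := by
    intro z
    have := eq_of_coordDeriv_eq_zero ((hS 2).add hd) (fun i z => ?_) z 0
    · simpa using this
    · rw [coordDeriv_add (hS 2) hd, coordDeriv_const_mul_sq]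
      fin_cases i
      · simp [hA, f0]
      · simp [h1i]
      · simp [hB, fconst z]; ring
      · simp [hcomm 3 2, h23]
      · simp [hfc, f2]
  refine ⟨f 0, coordDeriv 2 L 0, fun z => ?_⟩
  have e := hQ z 0
  have h3z : ∀ z, coordDeriv 3 L z = 0 := fun z => (h3'' z).trans (f0 z)
  unfold totalDeriv at e
  simp only [coordDeriv_zero_fun h3z, h3z, fconst z] at e
  have := hb z
  rw [e, ← this]
  ring

theorem contDiff_deriv {f : ℝ → ℝ} (hf : ContDiff ℝ (⊤ : ℕ∞) f) :
    ContDiff ℝ (⊤ : ℕ∞) (deriv f) := (contDiff_infty_iff_deriv.1 hf).2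

theorem hasDerivAt_of_contDiff {f : ℝ → ℝ} (hf : ContDiff ℝ (⊤ : ℕ∞) f) (x : ℝ) :
    HasDerivAt f (deriv f x) x := (hf.differentiable (by simp) x).hasDerivAt

theorem deriv_mul_eq {p p' l : ℝ → ℝ} (hp : ∀ y, HasDerivAt p (p' y) y)
    (hl : ContDiff ℝ (⊤ : ℕ∞) l) :
    deriv (fun y => p y * l y) = fun y => p' y * l y + p y * deriv l y :=
  funext fun y => ((hp y).fun_mul (hasDerivAt_of_contDiff hl y)).deriv

theorem coefficients_of_operator_identity {l₀ l₁ l₂ l₃ R : ℝ → ℝ}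
    (h₀ : ContDiff ℝ (⊤ : ℕ∞) l₀) (h₁ : ContDiff ℝ (⊤ : ℕ∞) l₁)
    (h₂ : ContDiff ℝ (⊤ : ℕ∞) l₂) (h₃ : ContDiff ℝ (⊤ : ℕ∞) l₃)
    (h : ∀ w : ℝ → ℝ, ContDiff ℝ (⊤ : ℕ∞) w → ∀ x,
      deriv (fun y => l₀ y * w y + l₁ y * deriv w y + l₂ y * deriv (deriv w) y
          + l₃ y * deriv (deriv (deriv w)) y) x
        + deriv w x * l₀ x - deriv (fun y => deriv w y * l₁ y) x
        + deriv (deriv (fun y => deriv w y * l₂ y)) x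
        - deriv (deriv (deriv (fun y => deriv w y * l₃ y))) x + R x = 0) :
    (∀ x, R x = 0) ∧ (∀ x, l₀ x = 0) ∧ ∀ x, l₂ x = deriv l₃ x := by
  have d := fun {f : ℝ → ℝ} (hf : ContDiff ℝ (⊤ : ℕ∞) f) => hasDerivAt_of_contDiff hf
  have hR : ∀ x, R x = 0 := by
    intro x
    simpa using h (fun _ => 0) contDiff_const x
  have e0 : ∀ x, deriv l₀ x = 0 := by
    intro x
    simpa [hR] using h (fun _ => 1) contDiff_const x
  have lin : ∀ x₀ : ℝ, deriv (fun y => y - x₀) = fun _ => 1 := fun x₀ =>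
    funext fun y => ((hasDerivAt_id' y).sub_const x₀).deriv
  have sq : ∀ x₀ : ℝ, deriv (fun y => (y - x₀) ^ 2 / 2) = fun y => y - x₀ := fun x₀ =>
    funext fun y => by
      rw [((((hasDerivAt_id' y).sub_const x₀).fun_pow 2).div_const 2).deriv]; simp
  have cub : ∀ x₀ : ℝ, deriv (fun y => (y - x₀) ^ 3 / 6) = fun y => (y - x₀) ^ 2 / 2 := fun x₀ =>
    funext fun y => by
      rw [((((hasDerivAt_id' y).sub_const x₀).fun_pow 3).div_const 6).deriv]; simp; ring
  have hlin : ∀ x₀ y : ℝ, HasDerivAt (fun y => y - x₀) 1 y := fun x₀ y =>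
    (hasDerivAt_id' y).sub_const x₀
  have hsq : ∀ x₀ y : ℝ, HasDerivAt (fun y => (y - x₀) ^ 2 / 2) (y - x₀) y := fun x₀ y => by
    exact ((((hasDerivAt_id' y).sub_const x₀).fun_pow 2).div_const 2).congr_deriv (by simp)
  have hcub : ∀ x₀ y : ℝ, HasDerivAt (fun y => (y - x₀) ^ 3 / 6) ((y - x₀) ^ 2 / 2) y :=
    fun x₀ y => by
      exact ((((hasDerivAt_id' y).sub_const x₀).fun_pow 3).div_const 6).congr_deriv (by simp; ring)
  have mlin : ∀ {l : ℝ → ℝ} (x₀ : ℝ), ContDiff ℝ (⊤ : ℕ∞) l →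
      deriv (fun y => (y - x₀) * l y) = fun y => l y + (y - x₀) * deriv l y := by
    intro l x₀ hl
    rw [deriv_mul_eq (hlin x₀) hl]; simp
  have mlin2 : ∀ {l : ℝ → ℝ} (x₀ : ℝ), ContDiff ℝ (⊤ : ℕ∞) l →
      deriv (deriv (fun y => (y - x₀) * l y))
        = fun y => 2 * deriv l y + (y - x₀) * deriv (deriv l) y := by
    intro l x₀ hl
    have := contDiff_deriv hl
    rw [mlin x₀ hl]
    funext y
    rw [((d hl y).fun_add ((hlin x₀ y).fun_mul (d this y))).deriv]
    ring
  have mlin3 : ∀ {l : ℝ → ℝ} (x₀ : ℝ), ContDiff ℝ (⊤ : ℕ∞) l →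
      deriv (deriv (deriv (fun y => (y - x₀) * l y))) x₀ = 3 * deriv (deriv l) x₀ := by
    intro l x₀ hl
    have h1 := contDiff_deriv hl
    have h2 := contDiff_deriv h1
    rw [mlin2 x₀ hl, (((d h1 x₀).const_mul 2).fun_add ((hlin x₀ x₀).fun_mul (d h2 x₀))).deriv]
    ring
  have msq : ∀ {l : ℝ → ℝ} (x₀ : ℝ), ContDiff ℝ (⊤ : ℕ∞) l →
      deriv (fun y => (y - x₀) ^ 2 / 2 * l y)
        = fun y => (y - x₀) * l y + (y - x₀) ^ 2 / 2 * deriv l y := by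
    intro l x₀ hl
    rw [deriv_mul_eq (hsq x₀) hl]
  have msq2 : ∀ {l : ℝ → ℝ} (x₀ : ℝ), ContDiff ℝ (⊤ : ℕ∞) l →
      deriv (deriv (fun y => (y - x₀) ^ 2 / 2 * l y))
        = fun y => l y + 2 * ((y - x₀) * deriv l y) + (y - x₀) ^ 2 / 2 * deriv (deriv l) y := by
    intro l x₀ hl
    have h1 := contDiff_deriv hl
    rw [msq x₀ hl]
    funext y
    rw [(((hlin x₀ y).fun_mul (d hl y)).fun_add ((hsq x₀ y).fun_mul (d h1 y))).deriv]
    ring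
  have msq3 : ∀ {l : ℝ → ℝ} (x₀ : ℝ), ContDiff ℝ (⊤ : ℕ∞) l →
      deriv (deriv (deriv (fun y => (y - x₀) ^ 2 / 2 * l y))) x₀ = 3 * deriv l x₀ := by
    intro l x₀ hl
    have h1 := contDiff_deriv hl
    have h2 := contDiff_deriv h1
    rw [msq2 x₀ hl, (((d hl x₀).fun_add (((hlin x₀ x₀).fun_mul (d h1 x₀)).const_mul 2)).fun_add
      ((hsq x₀ x₀).fun_mul (d h2 x₀))).deriv]
    simp; ring
  have e1 : ∀ x, 2 * l₀ x + deriv (deriv l₂) x - deriv (deriv (deriv l₃)) x = 0 := by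
    intro x
    have e := h (fun y => y - x) (contDiff_id.sub contDiff_const) x
    simp only [lin, hR, one_mul, mul_one, deriv_const', mul_zero, add_zero] at e
    rw [(((d h₀ x).fun_mul (hlin x x)).fun_add (d h₁ x)).deriv] at e
    simp at e
    linarith
  have e2 : ∀ x, deriv l₂ x = deriv (deriv l₃) x := by
    intro x
    have e := h (fun y => (y - x) ^ 2 / 2)
      (((contDiff_id.sub contDiff_const).pow 2).div_const 2) x
    simp only [sq, lin, hR, mul_one, deriv_const', mul_zero, add_zero, mlin3 x h₃, mlin2 x h₂,
      mlin x h₁] at e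
    rw [((((d h₀ x).fun_mul (hsq x x)).fun_add ((d h₁ x).fun_mul (hlin x x))).fun_add (d h₂ x)).deriv] at e
    simp at e
    linarith
  have e3 : ∀ x, l₂ x = deriv l₃ x := by
    intro x
    have e := h (fun y => (y - x) ^ 3 / 6)
      (((contDiff_id.sub contDiff_const).pow 3).div_const 6) x
    simp only [cub, sq, lin, hR, mul_one, add_zero, msq3 x h₃, msq2 x h₂,
      msq x h₁] at e
    rw [(((((d h₀ x).fun_mul (hcub x x)).fun_add ((d h₁ x).fun_mul (hsq x x))).fun_add
      ((d h₂ x).fun_mul (hlin x x))).fun_add (d h₃ x)).deriv] at e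
    simp at e
    linarith
  refine ⟨hR, fun x => ?_, e3⟩
  have := e1 x
  rw [show deriv l₂ = deriv (deriv l₃) from funext e2] at this
  linarith

/-- The jet of a function of one variable: the point, the value, and the first three
derivatives. -/
def spatialJet (v : ℝ → ℝ) (x : ℝ) : Fin 5 → ℝ :=
  ![x, v x, deriv v x, deriv (deriv v) x, deriv (deriv (deriv v)) x]

theorem contDiff_spatialJet {v : ℝ → ℝ} (hv : ContDiff ℝ (⊤ : ℕ∞) v) :
    ContDiff ℝ (⊤ : ℕ∞) (spatialJet v) := by
  have h1 := contDiff_deriv hv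
  have h2 := contDiff_deriv h1
  have h3 := contDiff_deriv h2
  refine contDiff_pi.2 fun i => ?_
  fin_cases i
  exacts [contDiff_id, hv, h1, h2, h3]

theorem hasDerivAt_comp_spatialJet {f : (Fin 5 → ℝ) → ℝ} (hf : ContDiff ℝ (⊤ : ℕ∞) f)
    {v : ℝ → ℝ} (hv : ContDiff ℝ (⊤ : ℕ∞) v) (x : ℝ) :
    HasDerivAt (fun y => f (spatialJet v y))
      (totalDeriv f (spatialJet v x) (deriv (deriv (deriv (deriv v))) x)) x := by
  have h1 := contDiff_deriv hv
  have h2 := contDiff_deriv h1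
  have h3 := contDiff_deriv h2
  convert hasDerivAt_comp_curve hf (c := spatialJet v) (x := x)
    (c' := ![1, deriv v x, deriv (deriv v) x, deriv (deriv (deriv v)) x,
      deriv (deriv (deriv (deriv v))) x]) ?_ using 1
  · simp [totalDeriv, Fin.sum_univ_five, spatialJet]
  · intro i
    fin_cases i
    exacts [hasDerivAt_id' x, hasDerivAt_of_contDiff hv x, hasDerivAt_of_contDiff h1 x,
      hasDerivAt_of_contDiff h2 x, hasDerivAt_of_contDiff h3 x]

theorem exists_spatialJet_eq (z : Fin 5 → ℝ) (s : ℝ) :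
    ∃ v : ℝ → ℝ, ContDiff ℝ (⊤ : ℕ∞) v ∧ spatialJet v (z 0) = z ∧
      deriv (deriv (deriv (deriv v))) (z 0) = s := by
  have key : ∀ a b c d e : ℝ, deriv (fun y => a + b * (y - z 0) + c * (y - z 0) ^ 2
      + d * (y - z 0) ^ 3 + e * (y - z 0) ^ 4) = fun y => b + (2 * c) * (y - z 0)
      + (3 * d) * (y - z 0) ^ 2 + (4 * e) * (y - z 0) ^ 3 + 0 * (y - z 0) ^ 4 := by
    intro a b c d e
    funext y
    have hl := (hasDerivAt_id' y).sub_const (z 0)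
    rw [(((((hl.const_mul b).const_add a).fun_add ((hl.fun_pow 2).const_mul c)).fun_add
      ((hl.fun_pow 3).const_mul d)).fun_add ((hl.fun_pow 4).const_mul e)).deriv]
    simp; ring
  have hy : ContDiff ℝ (⊤ : ℕ∞) (fun y : ℝ => y - z 0) := contDiff_id.sub contDiff_const
  refine ⟨fun y => z 1 + z 2 * (y - z 0) + z 3 / 2 * (y - z 0) ^ 2
      + z 4 / 6 * (y - z 0) ^ 3 + s / 24 * (y - z 0) ^ 4, by fun_prop, ?_, ?_⟩
  · unfold spatialJet
    simp only [key]
    ext i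
    fin_cases i <;> simp <;> ring
  · simp only [key]
    simp; ring

/-- The coefficient `∂Λ/∂u_k`, indexed by the position in the jet, along the jet of `v`. -/
def coeffAlong (L : (Fin 5 → ℝ) → ℝ) (v : ℝ → ℝ) (i : Fin 5) : ℝ → ℝ :=
  fun y => coordDeriv i L (spatialJet v y)

/-- The Euler operator of `(u_tx - g u) Λ` evaluated on `u = v + t w` at `t = 0`. -/
def EulerIdentity (g : ℝ → ℝ) (L : (Fin 5 → ℝ) → ℝ) (v w : ℝ → ℝ) (x : ℝ) : Prop :=
  deriv (fun y => coeffAlong L v 1 y * w y + coeffAlong L v 2 y * deriv w y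
      + coeffAlong L v 3 y * deriv (deriv w) y + coeffAlong L v 4 y * deriv (deriv (deriv w)) y) x
    + deriv w x * coeffAlong L v 1 x - deriv (fun y => deriv w y * coeffAlong L v 2 y) x
    + deriv (deriv (fun y => deriv w y * coeffAlong L v 3 y)) x
    - deriv (deriv (deriv (fun y => deriv w y * coeffAlong L v 4 y))) x
    + (-(deriv g (v x) * L (spatialJet v x)) - (g (v x) * coeffAlong L v 1 x
      - deriv (fun y => g (v y) * coeffAlong L v 2 y) x
      + deriv (deriv (fun y => g (v y) * coeffAlong L v 3 y)) x
      - deriv (deriv (deriv (fun y => g (v y) * coeffAlong L v 4 y))) x)) = 0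

theorem eq_of_eulerIdentity {g : ℝ → ℝ} (hg : ContDiff ℝ (⊤ : ℕ∞) g) {σ : ℝ} (hσ : σ ≠ 0)
    (hg2 : ∀ u, deriv (deriv g) u = σ * g u)
    (hind : ∀ α β : ℝ, (∀ u, α * g u + β * deriv g u = 0) → α = 0 ∧ β = 0)
    {L : (Fin 5 → ℝ) → ℝ} (hL : ContDiff ℝ (⊤ : ℕ∞) L)
    (hE : ∀ v w : ℝ → ℝ, ContDiff ℝ (⊤ : ℕ∞) v → ContDiff ℝ (⊤ : ℕ∞) w → ∀ x,
      EulerIdentity g L v w x) :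
    ∃ a b : ℝ, ∀ z, L z = a * (z 4 - σ * z 2 ^ 3 / 2) + b * z 2 := by
  have d := fun {f : ℝ → ℝ} (hf : ContDiff ℝ (⊤ : ℕ∞) f) => hasDerivAt_of_contDiff hf
  have hS := contDiff_coordDeriv hL
  have hSS := fun i j => contDiff_coordDeriv (hS j) i
  have hl : ∀ v, ContDiff ℝ (⊤ : ℕ∞) v → ∀ i, ContDiff ℝ (⊤ : ℕ∞) (coeffAlong L v i) :=
    fun v hv i => (hS i).comp (contDiff_spatialJet hv)
  have hop := fun v hv => coefficients_of_operator_identity (hl v hv 1) (hl v hv 2) (hl v hv 3)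
    (hl v hv 4) (fun w hw x => hE v w hv hw x)
  have hdl : ∀ v, ContDiff ℝ (⊤ : ℕ∞) v → ∀ i x, HasDerivAt (coeffAlong L v i)
      (totalDeriv (coordDeriv i L) (spatialJet v x) (deriv (deriv (deriv (deriv v))) x)) x :=
    fun v hv i x => hasDerivAt_comp_spatialJet (hS i) hv x
  have h1 : ∀ z, coordDeriv 1 L z = 0 := by
    intro z
    obtain ⟨v, hv, hz, -⟩ := exists_spatialJet_eq z 0
    have := (hop v hv).2.1 (z 0)
    rwa [coeffAlong, hz] at this
  have h3 : ∀ z s, coordDeriv 3 L z = totalDeriv (coordDeriv 4 L) z s := by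
    intro z s
    obtain ⟨v, hv, hz, hs⟩ := exists_spatialJet_eq z s
    have := (hop v hv).2.2 (z 0)
    rwa [(hdl v hv 4 (z 0)).deriv, coeffAlong, hz, hs] at this
  have hR : ∀ z s, g (z 1) * (totalDeriv (coordDeriv 2 L) z s + σ * (3 * z 2 * z 3
        * coordDeriv 4 L z + 2 * z 2 ^ 2 * totalDeriv (coordDeriv 4 L) z s))
      + deriv g (z 1) * (z 2 * coordDeriv 2 L z + σ * z 2 ^ 3 * coordDeriv 4 L z
      + z 4 * coordDeriv 4 L z + 2 * z 3 * coordDeriv 3 L z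
      + z 2 * totalDeriv (coordDeriv 3 L) z s - L z) = 0 := by
    intro z s
    obtain ⟨v, hv, hz, hs⟩ := exists_spatialJet_eq z s
    obtain ⟨hR, hl1, hl34⟩ := hop v hv
    have e := hR (z 0)
    have v1 := contDiff_deriv hv
    have v2 := contDiff_deriv v1
    have dG : ∀ y, HasDerivAt (fun y => g (v y)) (deriv g (v y) * deriv v y) y := fun y =>
      (d hg (v y)).comp y (d hv y)
    have dG' : ∀ y, HasDerivAt (fun y => deriv g (v y)) (σ * g (v y) * deriv v y) y := fun y => by
      rw [← hg2]; exact (d (contDiff_deriv hg) (v y)).comp y (d hv y)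
    have dl4 : ∀ y, HasDerivAt (coeffAlong L v 4) (coeffAlong L v 3 y) y := fun y => by
      rw [hl34]; exact d (hl v hv 4) y
    have dl3 := d (hl v hv 3)
    have dl3' := d (contDiff_deriv (hl v hv 3))
    have k3 : deriv (fun y => g (v y) * coeffAlong L v 3 y)
        = fun y => deriv g (v y) * deriv v y * coeffAlong L v 3 y
          + g (v y) * deriv (coeffAlong L v 3) y :=
      funext fun y => ((dG y).fun_mul (dl3 y)).deriv
    have k4 : deriv (fun y => g (v y) * coeffAlong L v 4 y)
        = fun y => deriv g (v y) * deriv v y * coeffAlong L v 4 y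
          + g (v y) * coeffAlong L v 3 y :=
      funext fun y => ((dG y).fun_mul (dl4 y)).deriv
    have k4' : deriv (deriv (fun y => g (v y) * coeffAlong L v 4 y))
        = fun y => (σ * g (v y) * deriv v y * deriv v y
              + deriv g (v y) * deriv (deriv v) y) * coeffAlong L v 4 y
            + deriv g (v y) * deriv v y * coeffAlong L v 3 y
          + (deriv g (v y) * deriv v y * coeffAlong L v 3 y
            + g (v y) * deriv (coeffAlong L v 3) y) := by
      rw [k4]
      exact funext fun y => (((((dG' y).fun_mul (d v1 y)).fun_mul (dl4 y))).fun_add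
        ((dG y).fun_mul (dl3 y))).deriv
    rw [k3, k4', hl1, ((dG (z 0)).fun_mul (hdl v hv 2 (z 0))).deriv,
      ((((dG' (z 0)).fun_mul (d v1 (z 0))).fun_mul (dl3 (z 0))).fun_add
        ((dG (z 0)).fun_mul (dl3' (z 0)))).deriv,
      (((((((((dG (z 0)).const_mul σ).fun_mul (d v1 (z 0))).fun_mul (d v1 (z 0))).fun_add
        ((dG' (z 0)).fun_mul (d v2 (z 0)))).fun_mul (dl4 (z 0))).fun_add
          (((dG' (z 0)).fun_mul (d v1 (z 0))).fun_mul (dl3 (z 0)))).fun_add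
        ((((dG' (z 0)).fun_mul (d v1 (z 0))).fun_mul (dl3 (z 0))).fun_add
          ((dG (z 0)).fun_mul (dl3' (z 0)))))).deriv, (hdl v hv 3 (z 0)).deriv] at e
    rw [← h3]
    simp only [coeffAlong, hz, hs] at e
    have z1 : v (z 0) = z 1 := congrFun hz 1
    have z2 : deriv v (z 0) = z 2 := congrFun hz 2
    have z3 : deriv (deriv v) (z 0) = z 3 := congrFun hz 3
    have z4 : deriv (deriv (deriv v)) (z 0) = z 4 := congrFun hz 4
    rw [z1, z2, z3, z4] at e
    linear_combination e
  have h1i : ∀ i z, coordDeriv 1 (coordDeriv i L) z = 0 := by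
    intro i z
    rw [coordDeriv_comm hL, coordDeriv_zero_fun h1]
  have h1ij : ∀ i j z, coordDeriv 1 (coordDeriv i (coordDeriv j L)) z = 0 := by
    intro i j z
    rw [coordDeriv_comm (hS j), coordDeriv_zero_fun (h1i j)]
  have htd : ∀ i z s u, totalDeriv (coordDeriv i L) (Function.update z 1 u) s
      = totalDeriv (coordDeriv i L) z s := by
    intro i z s u
    simp [totalDeriv, apply_update_of_coordDeriv_eq_zero (hSS _ _) (h1ij _ _)]
  have hPQ := fun z s => hind _ _ (fun u => by
    have e := hR (Function.update z 1 u) s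
    simp only [htd, apply_update_of_coordDeriv_eq_zero (hS _) (h1i _),
      apply_update_of_coordDeriv_eq_zero hL h1] at e
    simp only [Function.update_self, Function.update_of_ne (show (2 : Fin 5) ≠ 1 by decide),
      Function.update_of_ne (show (3 : Fin 5) ≠ 1 by decide),
      Function.update_of_ne (show (4 : Fin 5) ≠ 1 by decide)] at e
    rw [mul_comm (g u), mul_comm (deriv g u)] at e
    exact e)
  exact eq_of_determining_equations hL hσ h1 h3 (fun z s => (hPQ z s).1)
    (fun z s => (sub_eq_zero.1 (hPQ z s).2).symm)

open MeasureTheory in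
/-- The function of two variables `f` is integrable over the plane with integral zero. -/
def NullIntegral (f : ℝ → ℝ → ℝ) : Prop :=
  Integrable (fun p : ℝ × ℝ => f p.1 p.2) ∧ ∫ p : ℝ × ℝ, f p.1 p.2 = 0

/-- The function of two variables `f` has compact support. -/
def CompactSupport2 (f : ℝ → ℝ → ℝ) : Prop := HasCompactSupport (fun p : ℝ × ℝ => f p.1 p.2)

theorem NullIntegral.add {f g : ℝ → ℝ → ℝ} (hf : NullIntegral f) (hg : NullIntegral g) :
    NullIntegral (fun t x => f t x + g t x) :=
  ⟨hf.1.add hg.1, by rw [MeasureTheory.integral_add hf.1 hg.1, hf.2, hg.2, add_zero]⟩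

theorem NullIntegral.const_mul {f : ℝ → ℝ → ℝ} (hf : NullIntegral f) (c : ℝ) :
    NullIntegral (fun t x => c * f t x) :=
  ⟨hf.1.const_mul c, by rw [MeasureTheory.integral_const_mul, hf.2, mul_zero]⟩

theorem NullIntegral.sub {f g : ℝ → ℝ → ℝ} (hf : NullIntegral f) (hg : NullIntegral g) :
    NullIntegral (fun t x => f t x - g t x) :=
  ⟨hf.1.sub hg.1, by rw [MeasureTheory.integral_sub hf.1 hg.1, hf.2, hg.2, sub_zero]⟩

theorem Smooth2.hasDerivAt_fst {u : ℝ → ℝ → ℝ} (hu : Smooth2 u) (t x : ℝ) :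
    HasDerivAt (fun s => u s x) (fderiv ℝ (fun p : ℝ × ℝ => u p.1 p.2) (t, x) (1, 0)) t :=
  (((hu.differentiable (by simp)) (t, x)).hasFDerivAt.comp_hasDerivAt t
    ((hasDerivAt_id' t).prodMk (hasDerivAt_const t x)) :)

theorem Smooth2.hasDerivAt_snd {u : ℝ → ℝ → ℝ} (hu : Smooth2 u) (t x : ℝ) :
    HasDerivAt (fun y => u t y) (fderiv ℝ (fun p : ℝ × ℝ => u p.1 p.2) (t, x) (0, 1)) x :=
  (((hu.differentiable (by simp)) (t, x)).hasFDerivAt.comp_hasDerivAt x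
    ((hasDerivAt_const x t).prodMk (hasDerivAt_id' x)) :)

theorem Smooth2.pdt_eq {u : ℝ → ℝ → ℝ} (hu : Smooth2 u) (t x : ℝ) :
    pdt u t x = fderiv ℝ (fun p : ℝ × ℝ => u p.1 p.2) (t, x) (1, 0) :=
  (hu.hasDerivAt_fst t x).deriv

theorem Smooth2.pdx_eq {u : ℝ → ℝ → ℝ} (hu : Smooth2 u) (t x : ℝ) :
    pdx u t x = fderiv ℝ (fun p : ℝ × ℝ => u p.1 p.2) (t, x) (0, 1) :=
  (hu.hasDerivAt_snd t x).deriv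

theorem Smooth2.hasDerivAt_pdt {u : ℝ → ℝ → ℝ} (hu : Smooth2 u) (t x : ℝ) :
    HasDerivAt (fun s => u s x) (pdt u t x) t :=
  (hu.hasDerivAt_fst t x).differentiableAt.hasDerivAt

theorem Smooth2.hasDerivAt_pdx {u : ℝ → ℝ → ℝ} (hu : Smooth2 u) (t x : ℝ) :
    HasDerivAt (fun y => u t y) (pdx u t x) x :=
  (hu.hasDerivAt_snd t x).differentiableAt.hasDerivAt

theorem Smooth2.pdt {u : ℝ → ℝ → ℝ} (hu : Smooth2 u) : Smooth2 (pdt u) := by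
  have : (fun p : ℝ × ℝ => _root_.pdt u p.1 p.2)
      = fun p => fderiv ℝ (fun p : ℝ × ℝ => u p.1 p.2) p (1, 0) :=
    funext fun p => hu.pdt_eq p.1 p.2
  unfold Smooth2
  rw [this]
  exact (hu.fderiv_right (m := (⊤ : ℕ∞)) (by simp)).clm_apply contDiff_const

theorem Smooth2.pdx {u : ℝ → ℝ → ℝ} (hu : Smooth2 u) : Smooth2 (pdx u) := by
  have : (fun p : ℝ × ℝ => _root_.pdx u p.1 p.2)
      = fun p => fderiv ℝ (fun p : ℝ × ℝ => u p.1 p.2) p (0, 1) :=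
    funext fun p => hu.pdx_eq p.1 p.2
  unfold Smooth2
  rw [this]
  exact (hu.fderiv_right (m := (⊤ : ℕ∞)) (by simp)).clm_apply contDiff_const

theorem Smooth2.iterate_pdx {u : ℝ → ℝ → ℝ} (hu : Smooth2 u) (j : ℕ) :
    Smooth2 (_root_.pdx^[j] u) := by
  induction j with
  | zero => exact hu
  | succ j ih => rw [Function.iterate_succ_apply']; exact ih.pdx

theorem Smooth2.pd {u : ℝ → ℝ → ℝ} (hu : Smooth2 u) (i j : ℕ) : Smooth2 (pd i j u) := by
  unfold _root_.pd
  induction i with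
  | zero => exact hu.iterate_pdx j
  | succ i ih => rw [Function.iterate_succ_apply']; exact ih.pdt

theorem Smooth2.pdt_pdx_comm {u : ℝ → ℝ → ℝ} (hu : Smooth2 u) (t x : ℝ) :
    _root_.pdt (_root_.pdx u) t x = _root_.pdx (_root_.pdt u) t x := by
  have hd : DifferentiableAt ℝ (fderiv ℝ (fun p : ℝ × ℝ => u p.1 p.2)) (t, x) :=
    (hu.fderiv_right (m := (⊤ : ℕ∞)) (by simp)).differentiable (by simp) _
  have hsymm : IsSymmSndFDerivAt ℝ (fun p : ℝ × ℝ => u p.1 p.2) (t, x) :=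
    hu.contDiffAt.isSymmSndFDerivAt (by
      simp only [minSmoothness_of_isRCLikeNormedField]; exact WithTop.coe_le_coe.2 le_top)
  rw [hu.pdx.pdt_eq, hu.pdt.pdx_eq]
  simp only [hu.pdx_eq, hu.pdt_eq]
  rw [fderiv_clm_apply hd (differentiableAt_const _),
    fderiv_clm_apply hd (differentiableAt_const _)]
  simpa using hsymm _ _

theorem pdt_add_mul {u φ : ℝ → ℝ → ℝ} (hu : Smooth2 u) (hφ : Smooth2 φ) (ε : ℝ) :
    pdt (fun t x => u t x + ε * φ t x) = fun t x => pdt u t x + ε * pdt φ t x :=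
  funext fun t => funext fun x =>
    ((hu.hasDerivAt_pdt t x).fun_add ((hφ.hasDerivAt_pdt t x).const_mul ε)).deriv

theorem pdx_add_mul {u φ : ℝ → ℝ → ℝ} (hu : Smooth2 u) (hφ : Smooth2 φ) (ε : ℝ) :
    pdx (fun t x => u t x + ε * φ t x) = fun t x => pdx u t x + ε * pdx φ t x :=
  funext fun t => funext fun x =>
    ((hu.hasDerivAt_pdx t x).fun_add ((hφ.hasDerivAt_pdx t x).const_mul ε)).deriv

theorem pd_add_mul {u φ : ℝ → ℝ → ℝ} (hu : Smooth2 u) (hφ : Smooth2 φ) (ε : ℝ) (i j : ℕ) :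
    pd i j (fun t x => u t x + ε * φ t x) = fun t x => pd i j u t x + ε * pd i j φ t x := by
  have hx : pdx^[j] (fun t x => u t x + ε * φ t x)
      = fun t x => pdx^[j] u t x + ε * pdx^[j] φ t x := by
    induction j with
    | zero => rfl
    | succ j ih =>
      simp only [Function.iterate_succ_apply', ih]
      exact pdx_add_mul (hu.iterate_pdx j) (hφ.iterate_pdx j) ε
  unfold pd
  rw [hx]
  induction i with
  | zero => rfl
  | succ i ih =>
    simp only [Function.iterate_succ_apply', ih]
    exact pdt_add_mul (hu.pd i j) (hφ.pd i j) ε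

theorem Smooth2.add {u φ : ℝ → ℝ → ℝ} (hu : Smooth2 u) (hφ : Smooth2 φ) :
    Smooth2 (fun t x => u t x + φ t x) := ContDiff.add hu hφ

theorem Smooth2.mul {u φ : ℝ → ℝ → ℝ} (hu : Smooth2 u) (hφ : Smooth2 φ) :
    Smooth2 (fun t x => u t x * φ t x) := ContDiff.mul hu hφ

theorem Smooth2.const (c : ℝ) : Smooth2 (fun _ _ => c) := contDiff_const

theorem pdt_eq_zero_of_notMem {φ : ℝ → ℝ → ℝ} {K : Set (ℝ × ℝ)} (hK : IsClosed K)
    (h : ∀ p ∉ K, φ p.1 p.2 = 0) : ∀ p ∉ K, pdt φ p.1 p.2 = 0 := by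
  intro p hp
  have hev : (fun s => φ s p.2) =ᶠ[nhds p.1] fun _ => 0 := by
    have hc : Filter.Tendsto (fun s : ℝ => (s, p.2)) (nhds p.1) (nhds p) :=
      (Continuous.prodMk continuous_id continuous_const).tendsto' p.1 p rfl
    filter_upwards [hc (hK.isOpen_compl.mem_nhds hp)] with s hs using h _ hs
  exact hev.deriv_eq.trans (by simp)

theorem pdx_eq_zero_of_notMem {φ : ℝ → ℝ → ℝ} {K : Set (ℝ × ℝ)} (hK : IsClosed K)
    (h : ∀ p ∉ K, φ p.1 p.2 = 0) : ∀ p ∉ K, pdx φ p.1 p.2 = 0 := by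
  intro p hp
  have hev : (fun y => φ p.1 y) =ᶠ[nhds p.2] fun _ => 0 := by
    have hc : Filter.Tendsto (fun y : ℝ => (p.1, y)) (nhds p.2) (nhds p) :=
      (Continuous.prodMk continuous_const continuous_id).tendsto' p.2 p rfl
    filter_upwards [hc (hK.isOpen_compl.mem_nhds hp)] with s hs using h _ hs
  exact hev.deriv_eq.trans (by simp)

theorem pd_eq_zero_of_notMem {φ : ℝ → ℝ → ℝ} {K : Set (ℝ × ℝ)} (hK : IsClosed K)
    (h : ∀ p ∉ K, φ p.1 p.2 = 0) (i j : ℕ) : ∀ p ∉ K, pd i j φ p.1 p.2 = 0 := by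
  unfold pd
  induction i with
  | zero =>
    induction j with
    | zero => exact h
    | succ j ih => simp only [Function.iterate_succ_apply'] at ih ⊢; exact pdx_eq_zero_of_notMem hK ih
  | succ i ih => simp only [Function.iterate_succ_apply']; exact pdt_eq_zero_of_notMem hK ih

theorem CompactSupport2.eq_zero {φ : ℝ → ℝ → ℝ} :
    ∀ p ∉ tsupport (fun p : ℝ × ℝ => φ p.1 p.2), φ p.1 p.2 = 0 :=
  fun _ hp => image_eq_zero_of_notMem_tsupport (f := fun p : ℝ × ℝ => φ p.1 p.2) hp

theorem CompactSupport2.pdt {φ : ℝ → ℝ → ℝ} (hc : CompactSupport2 φ) :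
    CompactSupport2 (pdt φ) :=
  HasCompactSupport.intro hc (pdt_eq_zero_of_notMem (isClosed_tsupport _) CompactSupport2.eq_zero)

theorem CompactSupport2.pdx {φ : ℝ → ℝ → ℝ} (hc : CompactSupport2 φ) :
    CompactSupport2 (pdx φ) :=
  HasCompactSupport.intro hc (pdx_eq_zero_of_notMem (isClosed_tsupport _) CompactSupport2.eq_zero)

theorem CompactSupport2.mul_right {φ : ℝ → ℝ → ℝ} (hc : CompactSupport2 φ) (a : ℝ → ℝ → ℝ) :
    CompactSupport2 (fun t x => φ t x * a t x) :=
  HasCompactSupport.mul_right (f' := fun p : ℝ × ℝ => a p.1 p.2) hc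

theorem integrable_of_smooth_of_compactSupport {φ : ℝ → ℝ → ℝ} (hφ : Smooth2 φ)
    (hc : CompactSupport2 φ) : MeasureTheory.Integrable (fun p : ℝ × ℝ => φ p.1 p.2) :=
  hφ.continuous.integrable_of_hasCompactSupport hc

theorem nullIntegral_fderiv {f : ℝ × ℝ → ℝ} (hf : ContDiff ℝ (⊤ : ℕ∞) f)
    (hc : HasCompactSupport f) (v : ℝ × ℝ) : ∫ p, fderiv ℝ f p v = 0 := by
  have hd : Continuous (fun p => fderiv ℝ f p v) :=
    ((hf.fderiv_right (m := (⊤ : ℕ∞)) (by simp)).clm_apply contDiff_const).continuous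
  have h := integral_mul_fderiv_eq_neg_fderiv_mul_of_integrable (μ := MeasureTheory.volume)
    (f := fun _ : ℝ × ℝ => (1 : ℝ)) (g := f) (v := v) (by simp)
    (by simpa using hd.integrable_of_hasCompactSupport (hc.fderiv_apply (𝕜 := ℝ) v))
    (by simpa using hf.continuous.integrable_of_hasCompactSupport hc)
    (fun p _ => differentiableAt_const _) (fun p _ => hf.differentiable (by simp) p)
  simpa using h

theorem nullIntegral_pdt {φ : ℝ → ℝ → ℝ} (hφ : Smooth2 φ) (hc : CompactSupport2 φ) :
    NullIntegral (pdt φ) := by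
  refine ⟨integrable_of_smooth_of_compactSupport hφ.pdt hc.pdt, ?_⟩
  simp only [hφ.pdt_eq]
  exact nullIntegral_fderiv hφ hc (1, 0)

theorem nullIntegral_pdx {φ : ℝ → ℝ → ℝ} (hφ : Smooth2 φ) (hc : CompactSupport2 φ) :
    NullIntegral (pdx φ) := by
  refine ⟨integrable_of_smooth_of_compactSupport hφ.pdx hc.pdx, ?_⟩
  simp only [hφ.pdx_eq]
  exact nullIntegral_fderiv hφ hc (0, 1)

theorem nullIntegral_pdt_mul {φ a : ℝ → ℝ → ℝ} (hφ : Smooth2 φ) (hc : CompactSupport2 φ)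
    (ha : Smooth2 a) : NullIntegral (fun t x => pdt φ t x * a t x + φ t x * pdt a t x) := by
  convert nullIntegral_pdt (hφ.mul ha) (hc.mul_right a) using 3 with t x
  exact ((hφ.hasDerivAt_pdt t x).fun_mul (ha.hasDerivAt_pdt t x)).deriv.symm

theorem nullIntegral_pdx_mul {φ a : ℝ → ℝ → ℝ} (hφ : Smooth2 φ) (hc : CompactSupport2 φ)
    (ha : Smooth2 a) : NullIntegral (fun t x => pdx φ t x * a t x + φ t x * pdx a t x) := by
  convert nullIntegral_pdx (hφ.mul ha) (hc.mul_right a) using 3 with t x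
  exact ((hφ.hasDerivAt_pdx t x).fun_mul (ha.hasDerivAt_pdx t x)).deriv.symm

theorem jet_add_mul {u φ : ℝ → ℝ → ℝ} (hu : Smooth2 u) (hφ : Smooth2 φ) (ε : ℝ) (n : ℕ)
    (t x : ℝ) : jet n (fun t x => u t x + ε * φ t x) t x = jet n u t x + ε • jet n φ t x := by
  funext p
  simp [jet, pd_add_mul hu hφ]

theorem Smooth2.contDiff_jet {u : ℝ → ℝ → ℝ} (hu : Smooth2 u) (n : ℕ) :
    ContDiff ℝ (⊤ : ℕ∞) (fun p : ℝ × ℝ => jet n u p.1 p.2) :=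
  contDiff_pi.2 fun q => hu.pd q.1.1 q.1.2

/-- The first variation of the flux `Φ` at `u` in the direction `φ`. -/
def fluxVariation (Φ : ℝ × ℝ × (JetIdx 4 → ℝ) → ℝ) (u φ : ℝ → ℝ → ℝ) : ℝ → ℝ → ℝ :=
  fun t x => deriv (fun ε : ℝ => Φ (t, x, jet 4 u t x + ε • jet 4 φ t x)) 0

section FluxVariation

variable {Φ : ℝ × ℝ × (JetIdx 4 → ℝ) → ℝ} {u φ : ℝ → ℝ → ℝ}

theorem contDiff_flux_perturbed (hΦ : ContDiff ℝ (⊤ : ℕ∞) Φ) (hu : Smooth2 u) (hφ : Smooth2 φ) :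
    ContDiff ℝ (⊤ : ℕ∞) (fun q : ℝ × ℝ × ℝ =>
      Φ (q.2.1, q.2.2, jet 4 u q.2.1 q.2.2 + q.1 • jet 4 φ q.2.1 q.2.2)) := by
  have h1 : ContDiff ℝ (⊤ : ℕ∞) (fun q : ℝ × ℝ × ℝ => jet 4 u q.2.1 q.2.2) :=
    (hu.contDiff_jet 4).comp contDiff_snd
  have h2 : ContDiff ℝ (⊤ : ℕ∞) (fun q : ℝ × ℝ × ℝ => jet 4 φ q.2.1 q.2.2) :=
    (hφ.contDiff_jet 4).comp contDiff_snd
  exact hΦ.comp ((contDiff_fst.comp contDiff_snd).prodMk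
    ((contDiff_snd.comp contDiff_snd).prodMk (h1.add (contDiff_fst.smul h2))))

theorem smooth2_fluxVariation (hΦ : ContDiff ℝ (⊤ : ℕ∞) Φ) (hu : Smooth2 u) (hφ : Smooth2 φ) :
    Smooth2 (fluxVariation Φ u φ) := by
  have hA := contDiff_flux_perturbed hΦ hu hφ
  set A := fun q : ℝ × ℝ × ℝ =>
      Φ (q.2.1, q.2.2, jet 4 u q.2.1 q.2.2 + q.1 • jet 4 φ q.2.1 q.2.2) with hAdef
  have : (fun p : ℝ × ℝ => fluxVariation Φ u φ p.1 p.2)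
      = fun p => fderiv ℝ A (0, p.1, p.2) (1, 0, 0) := by
    funext p
    exact (((hA.differentiable (by simp)) (0, p.1, p.2)).hasFDerivAt.comp_hasDerivAt (0 : ℝ)
      ((hasDerivAt_id' (0 : ℝ)).prodMk (hasDerivAt_const (0 : ℝ) (p.1, p.2)))).deriv
  unfold Smooth2
  rw [this]
  exact ((hA.fderiv_right (m := (⊤ : ℕ∞)) (by simp)).comp
    (contDiff_const.prodMk contDiff_id)).clm_apply contDiff_const

theorem compactSupport2_fluxVariation (hc : CompactSupport2 φ) :
    CompactSupport2 (fluxVariation Φ u φ) := by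
  refine HasCompactSupport.intro hc fun p hp => ?_
  have : jet 4 φ p.1 p.2 = 0 := funext fun q =>
    pd_eq_zero_of_notMem (isClosed_tsupport _) CompactSupport2.eq_zero _ _ p hp
  simp [fluxVariation, this]

theorem deriv_deriv_flux_fst (hΦ : ContDiff ℝ (⊤ : ℕ∞) Φ) (hu : Smooth2 u) (hφ : Smooth2 φ)
    (t x : ℝ) :
    HasDerivAt (fun ε : ℝ => deriv (fun s => Φ (s, x, jet 4 u s x + ε • jet 4 φ s x)) t)
      (pdt (fluxVariation Φ u φ) t x) 0 := by
  have hB : Smooth2 (fun (ε s : ℝ) => Φ (s, x, jet 4 u s x + ε • jet 4 φ s x)) :=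
    (contDiff_flux_perturbed hΦ hu hφ).comp
      (contDiff_fst.prodMk (contDiff_snd.prodMk contDiff_const))
  have h := hB.pdx.hasDerivAt_pdt 0 t
  rw [hB.pdt_pdx_comm] at h
  exact h

theorem deriv_deriv_flux_snd (hΦ : ContDiff ℝ (⊤ : ℕ∞) Φ) (hu : Smooth2 u) (hφ : Smooth2 φ)
    (t x : ℝ) :
    HasDerivAt (fun ε : ℝ => deriv (fun y => Φ (t, y, jet 4 u t y + ε • jet 4 φ t y)) x)
      (pdx (fluxVariation Φ u φ) t x) 0 := by
  have hB : Smooth2 (fun (ε y : ℝ) => Φ (t, y, jet 4 u t y + ε • jet 4 φ t y)) :=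
    (contDiff_flux_perturbed hΦ hu hφ).comp
      (contDiff_fst.prodMk (contDiff_const.prodMk contDiff_snd))
  have h := hB.pdx.hasDerivAt_pdt 0 x
  rw [hB.pdt_pdx_comm] at h
  exact h

end FluxVariation

/-- The jet `(x, u, u_x, u_xx, u_xxx)` of a function of `(t, x)`. -/
def planeJet (u : ℝ → ℝ → ℝ) (t x : ℝ) : Fin 5 → ℝ :=
  ![x, u t x, pd 0 1 u t x, pd 0 2 u t x, pd 0 3 u t x]

theorem Smooth2.contDiff_planeJet {u : ℝ → ℝ → ℝ} (hu : Smooth2 u) :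
    ContDiff ℝ (⊤ : ℕ∞) (fun p : ℝ × ℝ => planeJet u p.1 p.2) := by
  refine contDiff_pi.2 fun i => ?_
  fin_cases i
  exacts [contDiff_snd, hu, hu.pd 0 1, hu.pd 0 2, hu.pd 0 3]

/-- The integral of the first variation of `(u_tx - g u) Λ` vanishes. -/
theorem nullIntegral_variation {g : ℝ → ℝ} (hg : ContDiff ℝ (⊤ : ℕ∞) g)
    {Λ : ℝ → ℝ → ℝ → ℝ → ℝ → ℝ} {L : (Fin 5 → ℝ) → ℝ} (hL : ContDiff ℝ (⊤ : ℕ∞) L)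
    (hLΛ : ∀ z, L z = Λ (z 0) (z 1) (z 2) (z 3) (z 4)) (hM : IsMultiplierKG g Λ)
    {u φ : ℝ → ℝ → ℝ} (hu : Smooth2 u) (hφ : Smooth2 φ) (hc : CompactSupport2 φ) :
    NullIntegral (fun t x => (pd 1 1 φ t x - deriv g (u t x) * φ t x) * L (planeJet u t x)
      + (pd 1 1 u t x - g (u t x)) * (φ t x * coordDeriv 1 L (planeJet u t x)
        + pd 0 1 φ t x * coordDeriv 2 L (planeJet u t x)
        + pd 0 2 φ t x * coordDeriv 3 L (planeJet u t x)
        + pd 0 3 φ t x * coordDeriv 4 L (planeJet u t x))) := by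
  obtain ⟨Φt, Φx, hΦt, hΦx, hΦ⟩ := hM
  convert (nullIntegral_pdt (smooth2_fluxVariation hΦt hu hφ)
    (compactSupport2_fluxVariation (Φ := Φt) (u := u) hc)).add
    (nullIntegral_pdx (smooth2_fluxVariation hΦx hu hφ)
    (compactSupport2_fluxVariation (Φ := Φx) (u := u) hc)) using 3 with t x
  have hR := (deriv_deriv_flux_fst hΦt hu hφ t x).fun_add (deriv_deriv_flux_snd hΦx hu hφ t x)
  have hlin : ∀ a b : ℝ, HasDerivAt (fun ε : ℝ => a + ε * b) b 0 := fun a b => by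
    simpa using ((hasDerivAt_id' (0 : ℝ)).mul_const b).const_add a
  have hgu : HasDerivAt (fun ε => g (u t x + ε * φ t x)) (deriv g (u t x) * φ t x) 0 := by
    refine HasDerivAt.comp (0 : ℝ) ?_ (hlin (u t x) (φ t x))
    simpa using hasDerivAt_of_contDiff hg (u t x)
  have hLu := hasDerivAt_comp_curve hL (x := 0)
    (c := fun ε => ![x, u t x + ε * φ t x, pd 0 1 u t x + ε * pd 0 1 φ t x,
      pd 0 2 u t x + ε * pd 0 2 φ t x, pd 0 3 u t x + ε * pd 0 3 φ t x])
    (c' := ![0, φ t x, pd 0 1 φ t x, pd 0 2 φ t x, pd 0 3 φ t x]) (by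
      intro i
      fin_cases i
      exacts [hasDerivAt_const _ _, hlin _ _, hlin _ _, hlin _ _, hlin _ _])
  have hF := ((hlin (pd 1 1 u t x) (pd 1 1 φ t x)).fun_sub hgu).fun_mul hLu
  have heq : (fun ε : ℝ => (pd 1 1 u t x + ε * pd 1 1 φ t x - g (u t x + ε * φ t x))
      * L ![x, u t x + ε * φ t x, pd 0 1 u t x + ε * pd 0 1 φ t x,
      pd 0 2 u t x + ε * pd 0 2 φ t x, pd 0 3 u t x + ε * pd 0 3 φ t x])
      = fun ε : ℝ => deriv (fun s => Φt (s, x, jet 4 u s x + ε • jet 4 φ s x)) t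
        + deriv (fun y => Φx (t, y, jet 4 u t y + ε • jet 4 φ t y)) x := by
    funext ε
    have h := hΦ (fun t x => u t x + ε * φ t x)
      (hu.add ((Smooth2.const ε).mul hφ)) t x
    simp only [pd_add_mul hu hφ, jet_add_mul hu hφ] at h
    rw [← h, hLΛ]
    rfl
  rw [heq] at hF
  rw [hR.unique hF]
  simp [Fin.sum_univ_five, planeJet]

theorem nullIntegral_iterate_pdx_mul {φ a : ℝ → ℝ → ℝ} (hφ : Smooth2 φ) (hc : CompactSupport2 φ)
    (ha : Smooth2 a) (k : ℕ) :
    NullIntegral (fun t x => pdx^[k] φ t x * a t x - (-1) ^ k * (φ t x * pdx^[k] a t x)) := by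
  induction k generalizing φ with
  | zero => simp [NullIntegral]
  | succ k ih =>
    convert (ih hφ.pdx hc.pdx).add
      ((nullIntegral_pdx_mul hφ hc (ha.iterate_pdx k)).const_mul ((-1) ^ k)) using 3 with t x
    rw [Function.iterate_succ_apply, Function.iterate_succ_apply']
    ring

theorem nullIntegral_pd_one_one_mul {φ a : ℝ → ℝ → ℝ} (hφ : Smooth2 φ) (hc : CompactSupport2 φ)
    (ha : Smooth2 a) :
    NullIntegral (fun t x => pd 1 1 φ t x * a t x - φ t x * pdx (pdt a) t x) := by
  convert (nullIntegral_pdt_mul hφ.pdx hc.pdx ha).sub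
    (nullIntegral_pdx_mul hφ hc ha.pdt) using 3 with t x
  simp only [pd, Function.iterate_succ_apply, Function.iterate_zero_apply]
  ring

theorem eq_zero_of_nullIntegral {f : ℝ → ℝ → ℝ} (hf : Smooth2 f)
    (h : ∀ φ : ℝ → ℝ → ℝ, Smooth2 φ → CompactSupport2 φ →
      NullIntegral (fun t x => φ t x * f t x)) (t x : ℝ) : f t x = 0 := by
  have hae := ae_eq_zero_of_integral_contDiff_smul_eq_zero
    (μ := (MeasureTheory.volume : MeasureTheory.Measure (ℝ × ℝ)))
    (hf.continuous.locallyIntegrable) (fun φ hφ hc => (h (fun t x => φ (t, x)) hφ hc).2)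
  have := (MeasureTheory.Measure.eq_of_ae_eq (g := fun _ => (0 : ℝ)) hae hf.continuous
    continuous_const)
  exact congrFun this (t, x)

/-- The Euler operator of `(u_tx - g u) Λ`. -/
def eulerOperator (g : ℝ → ℝ) (L : (Fin 5 → ℝ) → ℝ) (u : ℝ → ℝ → ℝ) : ℝ → ℝ → ℝ :=
  let l := fun (i : Fin 5) t x => coordDeriv i L (planeJet u t x)
  let h := fun (i : Fin 5) t x => pd 1 1 u t x * l i t x
  let k := fun (i : Fin 5) t x => g (u t x) * l i t x
  fun t x => pdx (pdt (fun t x => L (planeJet u t x))) t x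
    + h 1 t x - pdx (h 2) t x + pdx (pdx (h 3)) t x - pdx (pdx (pdx (h 4))) t x
    + (-(deriv g (u t x) * L (planeJet u t x))
      - (k 1 t x - pdx (k 2) t x + pdx (pdx (k 3)) t x - pdx (pdx (pdx (k 4))) t x))

theorem Smooth2.neg {u : ℝ → ℝ → ℝ} (hu : Smooth2 u) : Smooth2 (fun t x => -u t x) :=
  ContDiff.neg hu

theorem Smooth2.sub {u φ : ℝ → ℝ → ℝ} (hu : Smooth2 u) (hφ : Smooth2 φ) :
    Smooth2 (fun t x => u t x - φ t x) := ContDiff.sub hu hφ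

theorem eulerOperator_eq_zero {g : ℝ → ℝ} (hg : ContDiff ℝ (⊤ : ℕ∞) g)
    {Λ : ℝ → ℝ → ℝ → ℝ → ℝ → ℝ} {L : (Fin 5 → ℝ) → ℝ} (hL : ContDiff ℝ (⊤ : ℕ∞) L)
    (hLΛ : ∀ z, L z = Λ (z 0) (z 1) (z 2) (z 3) (z 4)) (hM : IsMultiplierKG g Λ)
    {u : ℝ → ℝ → ℝ} (hu : Smooth2 u) (t x : ℝ) : eulerOperator g L u t x = 0 := by
  have hLu : Smooth2 (fun t x => L (planeJet u t x)) := hL.comp hu.contDiff_planeJet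
  have hl : ∀ i, Smooth2 (fun t x => coordDeriv i L (planeJet u t x)) := fun i =>
    (contDiff_coordDeriv hL i).comp hu.contDiff_planeJet
  have hgu : Smooth2 (fun t x => g (u t x)) := hg.comp hu
  have hgu' : Smooth2 (fun t x => deriv g (u t x)) := (contDiff_deriv hg).comp hu
  have hh : ∀ i, Smooth2 (fun t x => pd 1 1 u t x * coordDeriv i L (planeJet u t x)) := fun i =>
    (hu.pd 1 1).mul (hl i)
  have hk : ∀ i, Smooth2 (fun t x => g (u t x) * coordDeriv i L (planeJet u t x)) := fun i =>
    hgu.mul (hl i)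
  refine eq_zero_of_nullIntegral ?_ (fun φ hφ hc => ?_) t x
  · exact (((((hLu.pdt.pdx).add (hh 1)).sub (hh 2).pdx).add (hh 3).pdx.pdx).sub
      (hh 4).pdx.pdx.pdx).add ((hgu'.mul hLu).neg.sub
      ((((hk 1).sub (hk 2).pdx).add (hk 3).pdx.pdx).sub (hk 4).pdx.pdx.pdx))
  · have hi := fun {a : ℝ → ℝ → ℝ} (ha : Smooth2 a) => nullIntegral_iterate_pdx_mul hφ hc ha
    convert (((((((nullIntegral_variation hg hL hLΛ hM hu hφ hc).sub
      (nullIntegral_pd_one_one_mul hφ hc hLu)).sub (hi (hh 2) 1)).sub (hi (hh 3) 2)).sub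
      (hi (hh 4) 3)).add (hi (hk 2) 1)).add (hi (hk 3) 2)).add (hi (hk 4) 3) using 3 with t x
    simp only [eulerOperator, pd, Function.iterate_succ_apply, Function.iterate_zero_apply]
    ring

theorem eulerIdentity_of_isMultiplierKG {g : ℝ → ℝ} (hg : ContDiff ℝ (⊤ : ℕ∞) g)
    {Λ : ℝ → ℝ → ℝ → ℝ → ℝ → ℝ} {L : (Fin 5 → ℝ) → ℝ} (hL : ContDiff ℝ (⊤ : ℕ∞) L)
    (hLΛ : ∀ z, L z = Λ (z 0) (z 1) (z 2) (z 3) (z 4)) (hM : IsMultiplierKG g Λ)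
    {v w : ℝ → ℝ} (hv : ContDiff ℝ (⊤ : ℕ∞) v) (hw : ContDiff ℝ (⊤ : ℕ∞) w) (x : ℝ) :
    EulerIdentity g L v w x := by
  have hpdx : ∀ {a b : ℝ → ℝ}, ContDiff ℝ (⊤ : ℕ∞) a → ContDiff ℝ (⊤ : ℕ∞) b →
      pdx (fun t x => a x + t * b x) = fun t x => deriv a x + t * deriv b x := by
    intro a b ha hb
    funext t x
    exact ((hasDerivAt_of_contDiff ha x).fun_add
      ((hasDerivAt_of_contDiff hb x).const_mul t)).deriv
  have hlin : ∀ a b t : ℝ, HasDerivAt (fun t : ℝ => a + t * b) b t := fun a b t => by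
    simpa using ((hasDerivAt_id' t).mul_const b).const_add a
  have hu : Smooth2 (fun t x => v x + t * w x) :=
    ((hv.comp contDiff_snd).add (contDiff_fst.mul (hw.comp contDiff_snd)) :)
  have v1 := contDiff_deriv hv
  have w1 := contDiff_deriv hw
  have v2 := contDiff_deriv v1
  have w2 := contDiff_deriv w1
  have hjet : planeJet (fun t x => v x + t * w x) = fun t x => ![x, v x + t * w x,
      deriv v x + t * deriv w x, deriv (deriv v) x + t * deriv (deriv w) x,
      deriv (deriv (deriv v)) x + t * deriv (deriv (deriv w)) x] := by
    funext t x
    simp only [planeJet, pd, Function.iterate_succ_apply, Function.iterate_zero_apply,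
      hpdx hv hw, hpdx v1 w1, hpdx v2 w2]
  have hjet0 : ∀ y, planeJet (fun t x => v x + t * w x) 0 y = spatialJet v y := by
    intro y
    simp [hjet, spatialJet]
  have hmix : ∀ y, pd 1 1 (fun t x => v x + t * w x) 0 y = deriv w y := by
    intro y
    simp only [pd, Function.iterate_succ_apply, Function.iterate_zero_apply, hpdx hv hw]
    exact (hlin _ _ 0).deriv
  have hLt : ∀ y, pdt (fun t x => L (planeJet (fun t x => v x + t * w x) t x)) 0 y
      = coeffAlong L v 1 y * w y + coeffAlong L v 2 y * deriv w y
      + coeffAlong L v 3 y * deriv (deriv w) y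
      + coeffAlong L v 4 y * deriv (deriv (deriv w)) y := by
    intro y
    have h := hasDerivAt_comp_curve hL (x := 0)
      (c := fun t => planeJet (fun t x => v x + t * w x) t y)
      (c' := ![0, w y, deriv w y, deriv (deriv w) y, deriv (deriv (deriv w)) y]) (by
        intro i
        rw [hjet]
        fin_cases i
        exacts [hasDerivAt_const _ _, hlin _ _ _, hlin _ _ _, hlin _ _ _, hlin _ _ _])
    refine h.deriv.trans ?_
    rw [hjet0]
    simp [Fin.sum_univ_five, coeffAlong]
    ring
  have e := eulerOperator_eq_zero hg hL hLΛ hM hu 0 x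
  simp only [eulerOperator, pdx, hLt, hjet0, hmix, zero_mul, add_zero] at e
  exact e

theorem isMultiplierKG_of_eq {g : ℝ → ℝ} (hg : ContDiff ℝ (⊤ : ℕ∞) g) {σ : ℝ} (hσ : σ * σ = 1)
    (hg2 : ∀ u, deriv (deriv g) u = σ * g u) {Λ : ℝ → ℝ → ℝ → ℝ → ℝ → ℝ} {a b : ℝ}
    (hΛ : ∀ x u p q r : ℝ, Λ x u p q r = a * (r - σ * p ^ 3 / 2) + b * p) :
    IsMultiplierKG g Λ := by
  have hg' := contDiff_deriv hg
  let u₀ : JetIdx 4 := ⟨(0, 0), by decide⟩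
  let p₀ : JetIdx 4 := ⟨(0, 1), by decide⟩
  let q₀ : JetIdx 4 := ⟨(0, 2), by decide⟩
  let m₀ : JetIdx 4 := ⟨(1, 1), by decide⟩
  have hc : ∀ i : JetIdx 4,
      ContDiff ℝ (⊤ : ℕ∞) (fun z : ℝ × ℝ × (JetIdx 4 → ℝ) => z.2.2 i) := fun i =>
    (contDiff_apply ℝ ℝ i).comp (contDiff_snd.comp contDiff_snd)
  refine ⟨fun z => a * (-(z.2.2 q₀ ^ 2) / 2 - σ * z.2.2 p₀ ^ 4 / 8) + b * (z.2.2 p₀ ^ 2 / 2),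
    fun z => a * (z.2.2 m₀ * z.2.2 q₀ - g (z.2.2 u₀) * z.2.2 q₀
      + deriv g (z.2.2 u₀) * z.2.2 p₀ ^ 2 / 2) - b * σ * deriv g (z.2.2 u₀), ?_, ?_, ?_⟩
  · have := hc q₀
    have := hc p₀
    fun_prop
  · have := hc q₀
    have := hc p₀
    have := hc m₀
    have := hg.comp (hc u₀)
    have := hg'.comp (hc u₀)
    simp only [Function.comp_def] at *
    fun_prop
  · intro u hu t x
    have hpt : HasDerivAt (fun s => pd 0 1 u s x) (pd 1 1 u t x) t :=
      (hu.pd 0 1).hasDerivAt_pdt t x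
    have hqt : HasDerivAt (fun s => pd 0 2 u s x) (pdx (pd 1 1 u) t x) t := by
      have h := (hu.pd 0 2).hasDerivAt_pdt t x
      have e : pdt (pd 0 2 u) t x = pdx (pd 1 1 u) t x := hu.pdx.pdt_pdx_comm t x
      rwa [e] at h
    have hux : HasDerivAt (fun y => u t y) (pd 0 1 u t x) x := hu.hasDerivAt_pdx t x
    have hpx : HasDerivAt (fun y => pd 0 1 u t y) (pd 0 2 u t x) x :=
      (hu.pd 0 1).hasDerivAt_pdx t x
    have hqx : HasDerivAt (fun y => pd 0 2 u t y) (pd 0 3 u t x) x :=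
      (hu.pd 0 2).hasDerivAt_pdx t x
    have hmx := (hu.pd 1 1).hasDerivAt_pdx t x
    have hgx : HasDerivAt (fun y => g (u t y)) (deriv g (u t x) * pd 0 1 u t x) x :=
      (hasDerivAt_of_contDiff hg (u t x)).comp x hux
    have hgx' : HasDerivAt (fun y => deriv g (u t y)) (σ * g (u t x) * pd 0 1 u t x) x := by
      have h := (hasDerivAt_of_contDiff hg' (u t x)).comp x hux
      rwa [hg2] at h
    have h1 := ((((hqt.fun_pow 2).fun_neg.div_const 2).fun_sub
      (((hpt.fun_pow 4).const_mul σ).div_const 8)).const_mul a).fun_add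
      (((hpt.fun_pow 2).div_const 2).const_mul b)
    have h2 := ((((hmx.fun_mul hqx).fun_sub (hgx.fun_mul hqx)).fun_add
      ((hgx'.fun_mul (hpx.fun_pow 2)).div_const 2)).const_mul a).fun_sub
      (hgx'.const_mul (b * σ))
    rw [hΛ]
    refine Eq.trans ?_ (congrArg₂ (· + ·) h1.deriv h2.deriv).symm
    push_cast
    linear_combination (b * g (u t x) * pd 0 1 u t x) * hσ

theorem isMultiplierKG_iff {g : ℝ → ℝ} (hg : ContDiff ℝ (⊤ : ℕ∞) g) {σ : ℝ} (hσ : σ * σ = 1)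
    (hg2 : ∀ u, deriv (deriv g) u = σ * g u)
    (hind : ∀ α β : ℝ, (∀ u, α * g u + β * deriv g u = 0) → α = 0 ∧ β = 0)
    {Λ : ℝ → ℝ → ℝ → ℝ → ℝ → ℝ} (hΛ : Smooth5 Λ) :
    IsMultiplierKG g Λ ↔
      ∃ a b : ℝ, ∀ x u p q r : ℝ, Λ x u p q r = a * (r - σ * p ^ 3 / 2) + b * p := by
  refine ⟨fun hM => ?_, fun ⟨a, b, h⟩ => isMultiplierKG_of_eq hg hσ hg2 h⟩
  have hL : ContDiff ℝ (⊤ : ℕ∞) (fun z : Fin 5 → ℝ => Λ (z 0) (z 1) (z 2) (z 3) (z 4)) :=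
    hΛ.comp (g := fun v : ℝ × ℝ × ℝ × ℝ × ℝ => Λ v.1 v.2.1 v.2.2.1 v.2.2.2.1 v.2.2.2.2)
      (f := fun z : Fin 5 → ℝ => (z 0, z 1, z 2, z 3, z 4)) (by fun_prop)
  obtain ⟨a, b, h⟩ := eq_of_eulerIdentity hg (left_ne_zero_of_mul_eq_one hσ) hg2 hind hL
    (fun v w hv hw x => eulerIdentity_of_isMultiplierKG hg hL (fun _ => rfl) hM hv hw x)
  exact ⟨a, b, fun x u p q r => h ![x, u, p, q, r]⟩

theorem deriv_exp_add_mul_exp_neg (c : ℝ) :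
    deriv (fun u => Real.exp u + c * Real.exp (-u))
      = fun u => Real.exp u + -c * Real.exp (-u) := by
  funext u
  have h := (Real.hasDerivAt_exp u).fun_add (((hasDerivAt_neg u).exp).const_mul c)
  rw [h.deriv]
  ring

theorem isMultiplierKG_exp_add_mul_exp_neg_iff {c : ℝ} (hc : c ≠ 0)
    {Λ : ℝ → ℝ → ℝ → ℝ → ℝ → ℝ} (hΛ : Smooth5 Λ) :
    IsMultiplierKG (fun u => Real.exp u + c * Real.exp (-u)) Λ ↔
      ∃ a b : ℝ, ∀ x u p q r : ℝ, Λ x u p q r = a * (r - p ^ 3 / 2) + b * p := by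
  rw [isMultiplierKG_iff (σ := 1) (by fun_prop) (by norm_num) ?_ ?_ hΛ]
  · simp only [one_mul]
  · intro u
    rw [deriv_exp_add_mul_exp_neg, deriv_exp_add_mul_exp_neg, neg_neg, one_mul]
  · intro α β h
    simp only [deriv_exp_add_mul_exp_neg] at h
    have h0 := h 0
    have h1 := h (Real.log 2)
    rw [Real.exp_neg, Real.exp_log (by norm_num)] at h1
    simp only [neg_zero, Real.exp_zero] at h0
    have hsum : α + β = 0 := by linarith
    have hdiff : c * (α - β) = 0 := by linarith
    have := (mul_eq_zero.1 hdiff).resolve_left hc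
    constructor <;> linarith

theorem isMultiplierKG_sin_iff {Λ : ℝ → ℝ → ℝ → ℝ → ℝ → ℝ} (hΛ : Smooth5 Λ) :
    IsMultiplierKG Real.sin Λ ↔
      ∃ a b : ℝ, ∀ x u p q r : ℝ, Λ x u p q r = a * (r + p ^ 3 / 2) + b * p := by
  rw [isMultiplierKG_iff (σ := -1) Real.contDiff_sin (by norm_num) ?_ ?_ hΛ]
  · simp only [neg_mul, one_mul, neg_div, sub_neg_eq_add]
  · intro u
    simp
  · intro α β h
    have h0 := h 0
    have h1 := h (Real.pi / 2)
    simp only [Real.deriv_sin, Real.sin_zero, Real.cos_zero, Real.sin_pi_div_two,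
      Real.cos_pi_div_two] at h0 h1
    constructor <;> linarith

/-- Classification of the conservation-law multipliers `Λ(x,u,u_x,u_xx,u_xxx)`
of the sine-Gordon equation `u_tx = sin u` and of the sinh-Gordon equations
`u_tx = eᵘ + e⁻ᵘ` and `u_tx = eᵘ − e⁻ᵘ`. -/
theorem sineGordon_sinhGordon_multiplier_classification
    (Λ : ℝ → ℝ → ℝ → ℝ → ℝ → ℝ) (hΛ : Smooth5 Λ) :
    (IsMultiplierKG Real.sin Λ ↔
      ∃ a b : ℝ, ∀ x u p q r : ℝ,
        Λ x u p q r = a * (r + p ^ 3 / 2) + b * p) ∧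
    (IsMultiplierKG (fun u => Real.exp u + Real.exp (-u)) Λ ↔
      ∃ a b : ℝ, ∀ x u p q r : ℝ,
        Λ x u p q r = a * (r - p ^ 3 / 2) + b * p) ∧
    (IsMultiplierKG (fun u => Real.exp u - Real.exp (-u)) Λ ↔
      ∃ a b : ℝ, ∀ x u p q r : ℝ,
        Λ x u p q r = a * (r - p ^ 3 / 2) + b * p) := by
  refine ⟨isMultiplierKG_sin_iff hΛ, ?_, ?_⟩
  · simpa only [one_mul] using isMultiplierKG_exp_add_mul_exp_neg_iff one_ne_zero hΛ
  · simpa only [neg_mul, one_mul, ← sub_eq_add_neg] using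
      isMultiplierKG_exp_add_mul_exp_neg_iff (neg_ne_zero.2 one_ne_zero) hΛ
end
end
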